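/- arXiv:1810.02185 — 2 statements merged into one kernel-verified Lean document; each statement's English description precedes it below -/
import Mathlib

section
/- Let K be an algebraically closed field and let (A, *) and (B, *) be finite-dimensional K-algebras with involution, each simple as an algebra with involution. If A and B satisfy the same polynomial identities with involution, then there is an isomorphism of algebras with involution between A and B, i.e., a bijective K-linear multiplicative map φ : A → B with φ(a*) = φ(a)* for all a ∈ A. -/
/-!
STATEMENT 8: Let K be an algebraically closed field, and let (A,*) and (B,*) be
finite-dimensional K-algebras with involution, each simple as an algebra with involution.
If A and B satisfy the same polynomial identities with involution, then there is an
isomorphism of algebras with involution between A and B.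
-/

/-- `I` is a two-sided ideal of the (not necessarily associative or unital) `K`-algebra `A`. -/
def IsIdeal {K A : Type*} [Field K] [NonUnitalNonAssocRing A] [Module K A]
    (I : Submodule K A) : Prop :=
  ∀ a ∈ I, ∀ b : A, a * b ∈ I ∧ b * a ∈ I

/-- `(A, st)` is simple as an algebra with involution: `A·A ≠ 0` and the only `*`-stable
two-sided ideals are `0` and `A`. -/
def IsStarSimple {K A : Type*} [Field K] [NonUnitalNonAssocRing A] [Module K A]
    (st : A →ₗ[K] A) : Prop :=
  (∃ a b : A, a * b ≠ 0) ∧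
    ∀ I : Submodule K A, (IsIdeal I ∧ ∀ a ∈ I, st a ∈ I) → I = ⊥ ∨ I = ⊤

/-- `f`, an element of the free nonassociative algebra with involution (the `K`-vector space
with basis the free magma on `ℕ × Bool`, where `(x, false)` plays the role of the generator
`x` and `(x, true)` that of `x*`), is a polynomial identity with involution of `(A, st)`:
for every `v : ℕ → A`, evaluating `x ↦ v x` and `x* ↦ st (v x)` kills `f`. -/
def IsStarPI {K A : Type*} [Field K] [NonUnitalNonAssocRing A] [Module K A]
    [SMulCommClass K A A] [IsScalarTower K A A] (st : A →ₗ[K] A)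
    (f : FreeNonUnitalNonAssocAlgebra K (ℕ × Bool)) : Prop :=
  ∀ v : ℕ → A,
    FreeNonUnitalNonAssocAlgebra.lift K
      (fun p : ℕ × Bool => if p.2 then st (v p.1) else v p.1) f = 0

open scoped TensorProduct

/-- Burnside's theorem on matrix algebras. -/
theorem Subalgebra.eq_top_of_forall_invariant {K V : Type*} [Field K] [IsAlgClosed K]
    [AddCommGroup V] [Module K V] [FiniteDimensional K V] [Nontrivial V]
    (E : Subalgebra K (Module.End K V))
    (hE : ∀ W : Submodule K V, (∀ T ∈ E, ∀ w ∈ W, T w ∈ W) → W = ⊥ ∨ W = ⊤) : E = ⊤ := by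
  have hsimple : IsSimpleModule E V := by
    refine isSimpleModule_iff .. |>.2 { eq_bot_or_eq_top := fun W => ?_ }
    have := hE (W.restrictScalars K) fun T hT w hw => W.smul_mem (⟨T, hT⟩ : E) hw
    simpa using this
  have hscalar : ∀ φ : Module.End E V, ∃ c : K, ∀ x, φ x = c • x := by
    intro φ
    obtain ⟨c, hc⟩ := Module.End.exists_eigenvalue (φ.restrictScalars K : Module.End K V)
    refine ⟨c, fun x => ?_⟩
    have h := hE (Module.End.eigenspace (φ.restrictScalars K : Module.End K V) c) ?_
    · have h := h.resolve_left hc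
      have hx : x ∈ Module.End.eigenspace (φ.restrictScalars K : Module.End K V) c := by
        rw [h]; trivial
      exact Module.End.mem_eigenspace_iff.1 hx
    · intro T hT w hw
      rw [Module.End.mem_eigenspace_iff] at hw ⊢
      have h1 : φ ((⟨T, hT⟩ : E) • w) = (⟨T, hT⟩ : E) • φ w := map_smul φ _ _
      change φ (T w) = T (φ w) at h1
      change φ w = c • w at hw
      change φ (T w) = c • T w
      rw [h1, hw, map_smul]
  rw [eq_top_iff]
  intro T _
  let f : Module.End (Module.End E V) V :=
    { toFun := T
      map_add' := map_add T
      map_smul' := fun φ x => by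
        obtain ⟨c, hc⟩ := hscalar φ
        simp [hc] }
  let b := Module.finBasis K V
  obtain ⟨r, hr⟩ := jacobson_density (R := E) f (Finset.univ.map ⟨b, b.injective⟩)
  have : T = r.1 := b.ext fun i => hr (b i) (by simp)
  exact this ▸ r.2

/-- The weak Nullstellensatz. -/
theorem nonempty_algHom_of_finiteType (K R : Type*) [Field K] [IsAlgClosed K]
    [CommRing R] [Algebra K R] [Algebra.FiniteType K R] [Nontrivial R] :
    Nonempty (R →ₐ[K] K) := by
  obtain ⟨N, hN⟩ := Ideal.exists_maximal R
  let _ : Field (R ⧸ N) := Ideal.Quotient.field N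
  have : Module.Finite K (R ⧸ N) := finite_of_finite_type_of_isJacobsonRing K (R ⧸ N)
  have : Algebra.IsIntegral K (R ⧸ N) := Algebra.IsIntegral.of_finite K _
  let e : K ≃ₐ[K] (R ⧸ N) := AlgEquiv.ofBijective (Algebra.ofId K _)
    (IsAlgClosed.algebraMap_bijective_of_isIntegral (k := K) (K := R ⧸ N))
  exact ⟨e.symm.toAlgHom.comp (Ideal.Quotient.mkₐ K N)⟩

/-- Two maps to finitely generated algebras with the same kernel have a common closed point
in their images. -/
theorem exists_algHom_comp_eq_of_ker_eq {K Z R S : Type*} [Field K] [IsAlgClosed K]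
    [CommRing Z] [CommRing R] [CommRing S] [Algebra K Z] [Algebra K R] [Algebra K S]
    [Algebra.FiniteType K R] [Algebra.FiniteType K S] [Nontrivial R]
    (f : Z →ₐ[K] R) (g : Z →ₐ[K] S) (h : ∀ z, f z = 0 ↔ g z = 0) :
    ∃ (χ : R →ₐ[K] K) (ψ : S →ₐ[K] K), χ.comp f = ψ.comp g := by
  have hker : (⊥ : Ideal R).comap f.toRingHom = (⊥ : Ideal S).comap g.toRingHom := by
    ext z; simpa using h z
  have hne : (⊥ : Ideal R).comap f.toRingHom ≠ ⊤ := Ideal.comap_ne_top _ bot_ne_top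
  obtain ⟨p, hp⟩ := Ideal.nonempty_minimalPrimes hne
  obtain ⟨P, hP, -, hPp⟩ := Ideal.exists_comap_eq_of_mem_minimalPrimes f.toRingHom p hp
  rw [hker] at hp
  obtain ⟨Q, hQ, -, hQp⟩ := Ideal.exists_comap_eq_of_mem_minimalPrimes g.toRingHom p hp
  let f' : (Z ⧸ p) →+* (R ⧸ P) := Ideal.quotientMap P f.toRingHom hPp.ge
  let g' : (Z ⧸ p) →+* (S ⧸ Q) := Ideal.quotientMap Q g.toRingHom hQp.ge
  algebraize [f', g']
  have : Nontrivial ((R ⧸ P) ⊗[Z ⧸ p] (S ⧸ Q)) :=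
    Algebra.TensorProduct.nontrivial_of_algebraMap_injective_of_isDomain _ _ _
      (Ideal.quotientMap_injective' hPp.le) (Ideal.quotientMap_injective' hQp.le)
  obtain ⟨M, hM⟩ := Ideal.exists_maximal ((R ⧸ P) ⊗[Z ⧸ p] (S ⧸ Q))
  let L := ((R ⧸ P) ⊗[Z ⧸ p] (S ⧸ Q)) ⧸ M
  let _ : Field L := Ideal.Quotient.field M
  have : IsScalarTower K (Z ⧸ p) (R ⧸ P) := .of_algebraMap_eq fun k => by
    change Ideal.Quotient.mk P _ = Ideal.Quotient.mk P (f _)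
    rw [f.commutes]
  have : IsScalarTower K (Z ⧸ p) (S ⧸ Q) := .of_algebraMap_eq fun k => by
    change Ideal.Quotient.mk Q _ = Ideal.Quotient.mk Q (g _)
    rw [g.commutes]
  let α : R →ₐ[K] L := (Ideal.Quotient.mkₐ K M).comp
    ((Algebra.TensorProduct.includeLeft (R := Z ⧸ p) (S := K) (A := R ⧸ P) (B := S ⧸ Q)).comp
      (Ideal.Quotient.mkₐ K P))
  let β : S →ₐ[K] L := (Ideal.Quotient.mkₐ K M).comp
    (((Algebra.TensorProduct.includeRight (R := Z ⧸ p) (A := R ⧸ P)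
      (B := S ⧸ Q)).restrictScalars K).comp (Ideal.Quotient.mkₐ K Q))
  have hαβ : ∀ z, α (f z) = β (g z) := fun z => by
    change Ideal.Quotient.mk M (algebraMap (Z ⧸ p) (R ⧸ P) (Ideal.Quotient.mk p z) ⊗ₜ 1) =
      Ideal.Quotient.mk M (1 ⊗ₜ algebraMap (Z ⧸ p) (S ⧸ Q) (Ideal.Quotient.mk p z))
    rw [Algebra.algebraMap_eq_smul_one, Algebra.algebraMap_eq_smul_one, TensorProduct.smul_tmul]
  let T : Subalgebra K L := α.range ⊔ β.range
  have hT : T.FG := by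
    refine Subalgebra.FG.sup ?_ ?_
    · rw [← Algebra.map_top]
      exact Subalgebra.FG.map _ Algebra.FiniteType.out
    · rw [← Algebra.map_top]
      exact Subalgebra.FG.map _ Algebra.FiniteType.out
  have : Algebra.FiniteType K T := Subalgebra.fg_iff_finiteType T |>.1 hT
  obtain ⟨π⟩ := nonempty_algHom_of_finiteType K T
  refine ⟨π.comp (α.codRestrict T fun r => le_sup_left (a := α.range) ⟨r, rfl⟩),
    π.comp (β.codRestrict T fun r => le_sup_right (b := β.range) ⟨r, rfl⟩), ?_⟩
  ext z
  change π _ = π _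
  congr 1
  exact Subtype.ext (hαβ z)

section PolynomialPairs

variable {K A B : Type*} [Field K]
  [NonUnitalNonAssocRing A] [Module K A] [SMulCommClass K A A] [IsScalarTower K A A]
  [NonUnitalNonAssocRing B] [Module K B] [SMulCommClass K B B] [IsScalarTower K B B]

/-- Evaluation of a polynomial with involution at `v`. -/
noncomputable def starEval (st : A →ₗ[K] A) (v : ℕ → A) :
    FreeNonUnitalNonAssocAlgebra K (ℕ × Bool) →ₙₐ[K] A :=
  FreeNonUnitalNonAssocAlgebra.lift K (fun p : ℕ × Bool => if p.2 then st (v p.1) else v p.1)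

/-- The formal involution of the free algebra, with values in the opposite algebra. -/
noncomputable def freeStar (K : Type*) [Field K] : FreeNonUnitalNonAssocAlgebra K (ℕ × Bool) →ₙₐ[K]
    (FreeNonUnitalNonAssocAlgebra K (ℕ × Bool))ᵐᵒᵖ :=
  FreeNonUnitalNonAssocAlgebra.lift K
    fun p => .op (FreeNonUnitalNonAssocAlgebra.of K (p.1, !p.2))

theorem starEval_freeStar {st : A →ₗ[K] A} (h1 : ∀ a, st (st a) = a)
    (h2 : ∀ a b, st (a * b) = st b * st a) (v : ℕ → A)
    (f : FreeNonUnitalNonAssocAlgebra K (ℕ × Bool)) :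
    starEval st v (freeStar K f).unop = st (starEval st v f) := by
  let F : FreeNonUnitalNonAssocAlgebra K (ℕ × Bool) →ₙₐ[K] Aᵐᵒᵖ :=
    { toFun := fun f => .op (starEval st v (freeStar K f).unop)
      map_smul' := by simp
      map_zero' := by simp
      map_add' := by simp
      map_mul' := by simp }
  let G : FreeNonUnitalNonAssocAlgebra K (ℕ × Bool) →ₙₐ[K] Aᵐᵒᵖ :=
    { toFun := fun f => .op (st (starEval st v f))
      map_smul' := by simp
      map_zero' := by simp
      map_add' := by simp
      map_mul' := by simp [h2] }
  have : F = G := by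
    refine FreeNonUnitalNonAssocAlgebra.hom_ext K fun ⟨i, b⟩ => ?_
    change MulOpposite.op _ = MulOpposite.op _
    cases b <;> simp [starEval, freeStar, h1]
  exact MulOpposite.op_injective (DFunLike.congr_fun this f)

/-- The pairs of functions on `A` and `B` induced by a common polynomial with involution. -/
def polyPairs (stA : A →ₗ[K] A) (stB : B →ₗ[K] B) :
    Submodule K (((ℕ → A) → A) × ((ℕ → B) → B)) where
  carrier := {p | ∃ f, (∀ v, starEval stA v f = p.1 v) ∧ ∀ v, starEval stB v f = p.2 v}
  zero_mem' := ⟨0, by simp⟩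
  add_mem' := by
    rintro p q ⟨f, hf, hf'⟩ ⟨g, hg, hg'⟩
    exact ⟨f + g, by simp [hf, hg], by simp [hf', hg']⟩
  smul_mem' := by
    rintro c p ⟨f, hf, hf'⟩
    exact ⟨c • f, by simp [hf], by simp [hf']⟩

variable {stA : A →ₗ[K] A} {stB : B →ₗ[K] B}

theorem polyPairs.mul_mem {p q : ((ℕ → A) → A) × ((ℕ → B) → B)}
    (hp : p ∈ polyPairs stA stB) (hq : q ∈ polyPairs stA stB) : p * q ∈ polyPairs stA stB := by
  obtain ⟨f, hf, hf'⟩ := hp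
  obtain ⟨g, hg, hg'⟩ := hq
  exact ⟨f * g, by simp [hf, hg], by simp [hf', hg']⟩

theorem polyPairs.coord_mem (i : ℕ) :
    ((fun v => v i, fun v => v i) : ((ℕ → A) → A) × ((ℕ → B) → B)) ∈ polyPairs stA stB :=
  ⟨.of K (i, false), by simp [starEval], by simp [starEval]⟩

theorem polyPairs.star_mem (hA1 : ∀ a, stA (stA a) = a) (hA2 : ∀ a b, stA (a * b) = stA b * stA a)
    (hB1 : ∀ a, stB (stB a) = a) (hB2 : ∀ a b, stB (a * b) = stB b * stB a)
    {p : ((ℕ → A) → A) × ((ℕ → B) → B)} (hp : p ∈ polyPairs stA stB) :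
    ((fun v => stA (p.1 v), fun v => stB (p.2 v)) : ((ℕ → A) → A) × ((ℕ → B) → B)) ∈
      polyPairs stA stB := by
  obtain ⟨f, hf, hf'⟩ := hp
  exact ⟨(freeStar K f).unop, by simp [starEval_freeStar hA1 hA2, hf],
    by simp [starEval_freeStar hB1 hB2, hf']⟩

theorem polyPairs.eq_zero (h : ∀ f, IsStarPI stA f → IsStarPI stB f)
    {p : ((ℕ → A) → A) × ((ℕ → B) → B)} (hp : p ∈ polyPairs stA stB) (h0 : p.1 = 0) :
    p.2 = 0 := by
  obtain ⟨f, hf, hf'⟩ := hp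
  funext v
  rw [← hf' v]
  exact h f (fun v => (hf v).trans (by simp [h0])) v

/-- Pairs of operator valued functions preserving `polyPairs`. -/
def polyOps (stA : A →ₗ[K] A) (stB : B →ₗ[K] B) :
    Subalgebra K (((ℕ → A) → Module.End K A) × ((ℕ → B) → Module.End K B)) where
  carrier := {S | ∀ p ∈ polyPairs stA stB,
    (fun v => S.1 v (p.1 v), fun v => S.2 v (p.2 v)) ∈ polyPairs stA stB}
  mul_mem' := fun hS hT p hp => hS _ (hT p hp)
  add_mem' := fun hS hT p hp => (polyPairs stA stB).add_mem (hS p hp) (hT p hp)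
  algebraMap_mem' := fun c _ hp => (polyPairs stA stB).smul_mem c hp

theorem polyOps.mulLeft_mem {p : ((ℕ → A) → A) × ((ℕ → B) → B)} (hp : p ∈ polyPairs stA stB) :
    ((fun v => LinearMap.mul K A (p.1 v), fun v => LinearMap.mul K B (p.2 v)) :
      ((ℕ → A) → Module.End K A) × ((ℕ → B) → Module.End K B)) ∈ polyOps stA stB :=
  fun _ hq => polyPairs.mul_mem hp hq

theorem polyOps.mulRight_mem {p : ((ℕ → A) → A) × ((ℕ → B) → B)} (hp : p ∈ polyPairs stA stB) :
    ((fun v => (LinearMap.mul K A).flip (p.1 v), fun v => (LinearMap.mul K B).flip (p.2 v)) :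
      ((ℕ → A) → Module.End K A) × ((ℕ → B) → Module.End K B)) ∈ polyOps stA stB :=
  fun _ hq => polyPairs.mul_mem hq hp

/-- If `v` generates `B`, operators of `B` all arise from `polyOps` at `v`. -/
theorem exists_mem_polyOps [IsAlgClosed K] [FiniteDimensional K B]
    (hA1 : ∀ a, stA (stA a) = a) (hA2 : ∀ a b, stA (a * b) = stA b * stA a)
    (hB1 : ∀ a, stB (stB a) = a) (hB2 : ∀ a b, stB (a * b) = stB b * stB a)
    (hBs : IsStarSimple stB) {v : ℕ → B}
    (hv : ∀ b, ∃ p ∈ polyPairs stA stB, p.2 v = b) (T : Module.End K B) :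
    ∃ S ∈ polyOps stA stB, S.2 v = T := by
  have : Nontrivial B := by
    obtain ⟨⟨a, b, hab⟩, -⟩ := hBs
    exact ⟨_, _, hab⟩
  let ev : (((ℕ → A) → Module.End K A) × ((ℕ → B) → Module.End K B)) →ₐ[K] Module.End K B :=
    (Pi.evalAlgHom K (fun _ : ℕ → B => Module.End K B) v).comp (AlgHom.snd K _ _)
  have key : (polyOps stA stB).map ev = ⊤ := by
    refine Subalgebra.eq_top_of_forall_invariant _ fun W hW => hBs.2 W ⟨fun a ha b => ?_, ?_⟩
    · obtain ⟨p, hp, rfl⟩ := hv b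
      exact ⟨hW _ ⟨_, polyOps.mulRight_mem hp, rfl⟩ a ha,
        hW _ ⟨_, polyOps.mulLeft_mem hp, rfl⟩ a ha⟩
    · exact fun a ha => hW _ ⟨(fun _ => stA, fun _ => stB),
        fun _ hp => polyPairs.star_mem hA1 hA2 hB1 hB2 hp, rfl⟩ a ha
  have hT : T ∈ (polyOps stA stB).map ev := key ▸ Algebra.mem_top
  obtain ⟨S, hS, h⟩ := hT
  exact ⟨S, hS, h⟩

end PolynomialPairs

section Alternators

variable {K A B : Type*} [Field K]
  [NonUnitalNonAssocRing A] [Module K A] [SMulCommClass K A A] [IsScalarTower K A A]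
  [NonUnitalNonAssocRing B] [Module K B] [SMulCommClass K B B] [IsScalarTower K B B]

/-- The alternating operator `∑ σ, sign σ • t (u₀ x_{σ 0}) t (u₁ x_{σ 1}) ⋯`. -/
noncomputable def altOp {n : ℕ} (t : Module.End K A) (u : Fin n → Module.End K A) :
    A [⋀^Fin n]→ₗ[K] Module.End K A :=
  MultilinearMap.alternatization ((MultilinearMap.mkPiAlgebraFin K n (Module.End K A)).compLinearMap
    fun i => (LinearMap.mulLeft K t) ∘ₗ LinearMap.mul K A ∘ₗ u i)

theorem altOp_apply {n : ℕ} (t : Module.End K A) (u : Fin n → Module.End K A) (x : Fin n → A) :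
    altOp t u x = ∑ σ : Equiv.Perm (Fin n), Equiv.Perm.sign σ •
      (List.ofFn fun i => t * LinearMap.mul K A (u i (x (σ i)))).prod := by
  simp [altOp, MultilinearMap.alternatization_apply, MultilinearMap.mkPiAlgebraFin_apply]

theorem altOp_basis_apply {n : ℕ} (b : Module.Basis (Fin n) K A) {t : Module.End K A}
    {u : Fin n → Module.End K A} {c d : A} (ht : t (c * d) = d)
    (hu : ∀ i j, u i (b j) = if i = j then c else 0) : altOp t u b d = d := by
  rw [altOp_apply, Finset.sum_eq_single 1]
  · simp only [hu, Equiv.Perm.sign_one, Equiv.Perm.one_apply, if_true, one_smul]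
    rw [List.ofFn_const, List.prod_replicate, Module.End.pow_apply]
    exact Function.iterate_fixed (by simpa using ht) n
  · intro σ _ hσ
    obtain ⟨i, hi⟩ : ∃ i, σ i ≠ i := by
      by_contra! h
      exact hσ (Equiv.ext h)
    rw [List.prod_eq_zero, smul_zero]
    rw [List.mem_ofFn]
    exact ⟨i, by simp [hu, Ne.symm hi]⟩
  · simp

variable {stA : A →ₗ[K] A} {stB : B →ₗ[K] B}

theorem altOp_mem_polyOps {n : ℕ}
    {T : ((ℕ → A) → Module.End K A) × ((ℕ → B) → Module.End K B)} (hT : T ∈ polyOps stA stB)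
    {U : Fin n → ((ℕ → A) → Module.End K A) × ((ℕ → B) → Module.End K B)}
    (hU : ∀ i, U i ∈ polyOps stA stB)
    {w : Fin n → ((ℕ → A) → A) × ((ℕ → B) → B)} (hw : ∀ i, w i ∈ polyPairs stA stB) :
    ((fun v => altOp (T.1 v) (fun i => (U i).1 v) (fun i => (w i).1 v),
      fun v => altOp (T.2 v) (fun i => (U i).2 v) (fun i => (w i).2 v)) :
      ((ℕ → A) → Module.End K A) × ((ℕ → B) → Module.End K B)) ∈ polyOps stA stB := by
  let L (i j : Fin n) : ((ℕ → A) → Module.End K A) × ((ℕ → B) → Module.End K B) :=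
    (fun v => LinearMap.mul K A ((U i).1 v ((w j).1 v)),
      fun v => LinearMap.mul K B ((U i).2 v ((w j).2 v)))
  have hL : ∀ i j, L i j ∈ polyOps stA stB := fun i j => polyOps.mulLeft_mem (hU i _ (hw j))
  have hsum : ∑ σ : Equiv.Perm (Fin n), ((Equiv.Perm.sign σ : ℤ) : K) •
      (List.ofFn fun i => T * L i (σ i)).prod ∈ polyOps stA stB := by
    refine sum_mem fun σ _ => Subalgebra.smul_mem _ (list_prod_mem fun x hx => ?_) _
    obtain ⟨i, rfl⟩ := List.mem_ofFn.1 hx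
    exact mul_mem hT (hL _ _)
  convert hsum using 1
  refine Prod.ext (funext fun v => ?_) (funext fun v => ?_)
  · let ev : (((ℕ → A) → Module.End K A) × ((ℕ → B) → Module.End K B)) →ₐ[K] Module.End K A :=
      (Pi.evalAlgHom K (fun _ : ℕ → A => Module.End K A) v).comp (AlgHom.fst K _ _)
    change _ = ev _
    refine (altOp_apply _ _ _).trans ?_
    rw [map_sum]
    refine Finset.sum_congr rfl fun σ _ => ?_
    refine Eq.trans ?_ (map_smul ev _ _).symm
    rw [Int.cast_smul_eq_zsmul, Units.smul_def, map_list_prod, List.map_ofFn]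
    rfl
  · let ev : (((ℕ → A) → Module.End K A) × ((ℕ → B) → Module.End K B)) →ₐ[K] Module.End K B :=
      (Pi.evalAlgHom K (fun _ : ℕ → B => Module.End K B) v).comp (AlgHom.snd K _ _)
    change _ = ev _
    refine (altOp_apply _ _ _).trans ?_
    rw [map_sum]
    refine Finset.sum_congr rfl fun σ _ => ?_
    refine Eq.trans ?_ (map_smul ev _ _).symm
    rw [Int.cast_smul_eq_zsmul, Units.smul_def, map_list_prod, List.map_ofFn]
    rfl

end Alternators

theorem AlternatingMap.apply_eq_det_smul {R M N ι : Type*} [CommRing R] [AddCommGroup M]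
    [Module R M] [AddCommGroup N] [Module R N] [Fintype ι] [DecidableEq ι]
    (e : Module.Basis ι R M) (f : M [⋀^ι]→ₗ[R] N) (x : ι → M) : f x = e.det x • f e := by
  suffices h : f = (LinearMap.toSpanSingleton R N (f e)).compAlternatingMap e.det by
    conv_lhs => rw [h]
    simp
  refine Module.Basis.ext_alternating e fun v hv => ?_
  let σ : Equiv.Perm ι := Equiv.ofBijective v (Finite.injective_iff_bijective.1 hv)
  have hσ : (fun i => e (v i)) = e ∘ σ := rfl
  simp [hσ, AlternatingMap.map_perm, e.det_self]

section DetPairs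

variable {K A B : Type*} [Field K]
  [NonUnitalNonAssocRing A] [Module K A] [SMulCommClass K A A] [IsScalarTower K A A]
  [NonUnitalNonAssocRing B] [Module K B] [SMulCommClass K B B] [IsScalarTower K B B]
  {stA : A →ₗ[K] A} {stB : B →ₗ[K] B} {n : ℕ}

theorem exists_mem_polyPairs (b : Module.Basis (Fin n) K B) {v : ℕ → B}
    (hv : ∀ i : Fin n, v i = b i) (x : B) : ∃ p ∈ polyPairs stA stB, p.2 v = x := by
  refine ⟨∑ i : Fin n, b.repr x i • (fun v => v i, fun v => v i),
    sum_mem fun i _ => Submodule.smul_mem _ _ (polyPairs.coord_mem i), ?_⟩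
  conv_rhs => rw [← b.sum_repr x]
  simp [Prod.snd_sum, hv]

theorem exists_altOp_ne_zero [IsAlgClosed K] [FiniteDimensional K B]
    (hA1 : ∀ a, stA (stA a) = a) (hA2 : ∀ a b, stA (a * b) = stA b * stA a)
    (hB1 : ∀ a, stB (stB a) = a) (hB2 : ∀ a b, stB (a * b) = stB b * stB a)
    (hBs : IsStarSimple stB) (b : Module.Basis (Fin n) K B) {v : ℕ → B}
    (hv : ∀ i : Fin n, v i = b i) :
    ∃ T ∈ polyOps stA stB, ∃ U : Fin n → _, (∀ i, U i ∈ polyOps stA stB) ∧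
      altOp (T.2 v) (fun i => (U i).2 v) b ≠ 0 := by
  obtain ⟨c, d, hcd⟩ := hBs.1
  have hsurj := exists_mem_polyOps hA1 hA2 hB1 hB2 hBs (exists_mem_polyPairs b hv)
  obtain ⟨φ, hφ⟩ : ∃ φ : Module.Dual K B, φ (c * d) ≠ 0 := by
    by_contra! h
    exact hcd ((Module.forall_dual_apply_eq_zero_iff K _).1 h)
  obtain ⟨T, hT, hTv⟩ := hsurj ((φ (c * d))⁻¹ • φ.smulRight d)
  choose U hU hUv using fun i => hsurj ((b.coord i).smulRight c)
  refine ⟨T, hT, U, hU, fun h => ?_⟩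
  have key := altOp_basis_apply (t := T.2 v) (u := fun i => (U i).2 v) (c := c) (d := d) b
    (by simp [hTv, hφ]) (fun i j => by
      rw [hUv]
      by_cases hij : i = j
      · simp [hij]
      · simp [hij])
  rw [h] at key
  exact hcd (by rw [← key]; simp)

theorem finrank_le_of_starIdentities [IsAlgClosed K] [FiniteDimensional K A]
    [FiniteDimensional K B]
    (hA1 : ∀ a, stA (stA a) = a) (hA2 : ∀ a b, stA (a * b) = stA b * stA a)
    (hB1 : ∀ a, stB (stB a) = a) (hB2 : ∀ a b, stB (a * b) = stB b * stB a)
    (hBs : IsStarSimple stB) (h : ∀ f, IsStarPI stA f → IsStarPI stB f) :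
    Module.finrank K B ≤ Module.finrank K A := by
  by_contra! hlt
  let b := Module.finBasis K B
  let v : ℕ → B := fun i => if hi : i < Module.finrank K B then b ⟨i, hi⟩ else 0
  have hv : ∀ i : Fin _, v i = b i := fun i => by simp [v]
  obtain ⟨T, hT, U, hU, hne⟩ := exists_altOp_ne_zero hA1 hA2 hB1 hB2 hBs b hv
  refine hne (LinearMap.ext fun x => ?_)
  obtain ⟨p, hp, rfl⟩ := exists_mem_polyPairs (stA := stA) (stB := stB) b hv x
  have hmem := altOp_mem_polyOps hT hU (fun i : Fin _ => polyPairs.coord_mem i) p hp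
  have h0 := congrFun (polyPairs.eq_zero h hmem (funext fun v => ?_)) v
  · simpa [hv] using h0
  · have hdep : ¬ LinearIndependent K (fun i : Fin (Module.finrank K B) => v i) := fun hli => by
      have := hli.fintype_card_le_finrank
      simp at this
      omega
    simp [AlternatingMap.map_linearDependent _ _ hdep]

/-- The span of the determinants of tuples of polynomials with involution. -/
noncomputable def detPairs (stA : A →ₗ[K] A) (stB : B →ₗ[K] B) (bA : Module.Basis (Fin n) K A)
    (bB : Module.Basis (Fin n) K B) : Submodule K (((ℕ → A) → K) × ((ℕ → B) → K)) :=
  Submodule.span K {q | ∃ w : Fin n → ((ℕ → A) → A) × ((ℕ → B) → B),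
    (∀ i, w i ∈ polyPairs stA stB) ∧
      q = (fun v => bA.det fun i => (w i).1 v, fun v => bB.det fun i => (w i).2 v)}

/-- Multiplication of a pair of vector valued functions by pairs of scalar functions. -/
def smulPair (K : Type*) {A B : Type*} [Field K] [AddCommGroup A] [Module K A]
    [AddCommGroup B] [Module K B] (p : ((ℕ → A) → A) × ((ℕ → B) → B)) :
    (((ℕ → A) → K) × ((ℕ → B) → K)) →ₗ[K] ((ℕ → A) → A) × ((ℕ → B) → B) where
  toFun q := (fun v => q.1 v • p.1 v, fun v => q.2 v • p.2 v)
  map_add' q r := by ext <;> simp [add_smul]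
  map_smul' c q := by ext <;> simp [mul_smul]

theorem smulPair_altOp_mem (bA : Module.Basis (Fin n) K A) (bB : Module.Basis (Fin n) K B)
    {T : ((ℕ → A) → Module.End K A) × ((ℕ → B) → Module.End K B)} (hT : T ∈ polyOps stA stB)
    {U : Fin n → ((ℕ → A) → Module.End K A) × ((ℕ → B) → Module.End K B)}
    (hU : ∀ i, U i ∈ polyOps stA stB) {k : ℕ} {p : ((ℕ → A) → A) × ((ℕ → B) → B)}
    (hp : detPairs stA stB bA bB ^ k ≤ (polyPairs stA stB).comap (smulPair K p)) :
    detPairs stA stB bA bB ^ (k + 1) ≤ (polyPairs stA stB).comap (smulPair K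
      (fun v => altOp (T.1 v) (fun i => (U i).1 v) bA (p.1 v),
        fun v => altOp (T.2 v) (fun i => (U i).2 v) bB (p.2 v))) := by
  rw [pow_succ, Submodule.mul_le]
  intro r hr q hq
  suffices detPairs stA stB bA bB ≤ ((polyPairs stA stB).comap (smulPair K
      (fun v => altOp (T.1 v) (fun i => (U i).1 v) bA (p.1 v),
        fun v => altOp (T.2 v) (fun i => (U i).2 v) bB (p.2 v)))).comap
      (LinearMap.mulLeft K r) from this hq
  rw [detPairs, Submodule.span_le]
  rintro _ ⟨w, hw, rfl⟩
  have hmem := altOp_mem_polyOps hT hU hw _ (hp hr)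
  change smulPair K _ (r * _) ∈ polyPairs stA stB
  convert hmem using 1
  refine Prod.ext ?_ ?_ <;> funext v
  · change (r.1 v * bA.det fun i => (w i).1 v) • _ = altOp _ _ (fun i => (w i).1 v) (r.1 v • p.1 v)
    rw [AlternatingMap.apply_eq_det_smul bA (altOp _ _) fun i => (w i).1 v]
    simp only [LinearMap.smul_apply, map_smul, smul_smul]
  · change (r.2 v * bB.det fun i => (w i).2 v) • _ = altOp _ _ (fun i => (w i).2 v) (r.2 v • p.2 v)
    rw [AlternatingMap.apply_eq_det_smul bB (altOp _ _) fun i => (w i).2 v]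
    simp only [LinearMap.smul_apply, map_smul, smul_smul]

theorem exists_detPairs_pow_smul_mem [IsAlgClosed K] [FiniteDimensional K B]
    (hA1 : ∀ a, stA (stA a) = a) (hA2 : ∀ a b, stA (a * b) = stA b * stA a)
    (hB1 : ∀ a, stB (stB a) = a) (hB2 : ∀ a b, stB (a * b) = stB b * stB a)
    (hBs : IsStarSimple stB) (bA : Module.Basis (Fin n) K A) (bB b : Module.Basis (Fin n) K B)
    {v : ℕ → B} (hv : ∀ i : Fin n, v i = b i) (k : ℕ) (x : B) :
    ∃ p, detPairs stA stB bA bB ^ k ≤ (polyPairs stA stB).comap (smulPair K p) ∧ p.2 v = x := by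
  induction k generalizing x with
  | zero =>
    obtain ⟨p, hp, rfl⟩ := exists_mem_polyPairs (stA := stA) (stB := stB) b hv x
    refine ⟨p, ?_, rfl⟩
    rw [pow_zero, Submodule.one_le]
    simpa [smulPair] using hp
  | succ k ih =>
    obtain ⟨T, hT, U, hU, hne⟩ := exists_altOp_ne_zero hA1 hA2 hB1 hB2 hBs b hv
    rw [AlternatingMap.apply_eq_det_smul bB] at hne
    obtain ⟨d, hd⟩ : ∃ d, altOp (T.2 v) (fun i => (U i).2 v) bB d ≠ 0 := by
      by_contra! h
      exact hne (LinearMap.ext fun d => by simp [h])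
    obtain ⟨p, hp, rfl⟩ := ih d
    have hp' := smulPair_altOp_mem bA bB hT hU hp
    obtain ⟨φ, hφ⟩ : ∃ φ : Module.Dual K B,
        φ (altOp (T.2 v) (fun i => (U i).2 v) bB (p.2 v)) ≠ 0 := by
      by_contra! h
      exact hd ((Module.forall_dual_apply_eq_zero_iff K _).1 h)
    obtain ⟨S, hS, hSv⟩ := exists_mem_polyOps hA1 hA2 hB1 hB2 hBs (exists_mem_polyPairs b hv)
      ((φ (altOp (T.2 v) (fun i => (U i).2 v) bB (p.2 v)))⁻¹ • φ.smulRight x)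
    refine ⟨(fun v => S.1 v (altOp (T.1 v) (fun i => (U i).1 v) bA (p.1 v)),
      fun v => S.2 v (altOp (T.2 v) (fun i => (U i).2 v) bB (p.2 v))), fun q hq => ?_, ?_⟩
    · have := hS _ (hp' hq)
      simpa [smulPair] using this
    · simp [hSv, hφ]

theorem detPairs_pow_snd_eq_zero [IsAlgClosed K] [FiniteDimensional K B]
    (hA1 : ∀ a, stA (stA a) = a) (hA2 : ∀ a b, stA (a * b) = stA b * stA a)
    (hB1 : ∀ a, stB (stB a) = a) (hB2 : ∀ a b, stB (a * b) = stB b * stB a)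
    (hBs : IsStarSimple stB) (h : ∀ f, IsStarPI stA f → IsStarPI stB f)
    (bA : Module.Basis (Fin n) K A) (bB b : Module.Basis (Fin n) K B)
    {v : ℕ → B} (hv : ∀ i : Fin n, v i = b i) {k : ℕ} {q : ((ℕ → A) → K) × ((ℕ → B) → K)}
    (hq : q ∈ detPairs stA stB bA bB ^ k) (h0 : q.1 = 0) : q.2 v = 0 := by
  obtain ⟨c, d, hcd⟩ := hBs.1
  obtain ⟨p, hp, hpv⟩ :=
    exists_detPairs_pow_smul_mem hA1 hA2 hB1 hB2 hBs bA bB b hv k (c * d)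
  have := congrFun (polyPairs.eq_zero h (hp hq) (by funext v; simp [smulPair, h0])) v
  have : q.2 v • p.2 v = 0 := this
  rw [hpv] at this
  exact (smul_eq_zero.1 this).resolve_right hcd

end DetPairs

section StructureConstants

variable {K A B : Type*} [Field K]
  [NonUnitalNonAssocRing A] [Module K A] [NonUnitalNonAssocRing B] [Module K B]
  {stA : A →ₗ[K] A} {stB : B →ₗ[K] B} {n : ℕ}

/-- The structure constants of the multiplication and the involution in a basis. -/
noncomputable def structConst (st : A →ₗ[K] A) (b : Module.Basis (Fin n) K A) :
    (Fin n × Fin n) ⊕ Fin n → Fin n → K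
  | .inl (i, j), k => b.repr (b i * b j) k
  | .inr i, k => b.repr (st (b i)) k

theorem Module.Basis.det_update {R M ι : Type*} [CommRing R] [AddCommGroup M] [Module R M]
    [Fintype ι] [DecidableEq ι] (e b : Module.Basis ι R M) (k : ι) (x : M) :
    e.det (Function.update b k x) = e.det b * b.repr x k := by
  rw [AlternatingMap.apply_eq_det_smul b e.det, smul_eq_mul, mul_comm]
  congr 1
  conv_lhs => rw [← b.sum_repr x]
  rw [AlternatingMap.map_update_sum, Finset.sum_eq_single k]
  · simp [AlternatingMap.map_update_smul, b.det_self]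
  · intro j _ hj
    rw [AlternatingMap.map_update_smul, AlternatingMap.map_update_self _ _ hj.symm, smul_zero]
  · simp

variable [SMulCommClass K A A] [IsScalarTower K A A] [SMulCommClass K B B] [IsScalarTower K B B]

theorem exists_mem_detPairs
    (hA1 : ∀ a, stA (stA a) = a) (hA2 : ∀ a b, stA (a * b) = stA b * stA a)
    (hB1 : ∀ a, stB (stB a) = a) (hB2 : ∀ a b, stB (a * b) = stB b * stB a)
    (bA : Module.Basis (Fin n) K A) (bB : Module.Basis (Fin n) K B)
    (s : (Fin n × Fin n) ⊕ Fin n) (k : Fin n) :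
    ∃ q ∈ detPairs stA stB bA bB,
      (∀ (a : Module.Basis (Fin n) K A) (v : ℕ → A), (∀ i : Fin n, v i = a i) →
        q.1 v = bA.det a * structConst stA a s k) ∧
      (∀ (b : Module.Basis (Fin n) K B) (v : ℕ → B), (∀ i : Fin n, v i = b i) →
        q.2 v = bB.det b * structConst stB b s k) := by
  let x (i : Fin n) : ((ℕ → A) → A) × ((ℕ → B) → B) := (fun v => v i, fun v => v i)
  have hx : ∀ i, x i ∈ polyPairs stA stB := fun i => polyPairs.coord_mem i
  obtain ⟨p, hp, hpA, hpB⟩ : ∃ p ∈ polyPairs stA stB,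
      (∀ (a : Module.Basis (Fin n) K A) (v : ℕ → A), (∀ i : Fin n, v i = a i) →
        a.repr (p.1 v) k = structConst stA a s k) ∧
      (∀ (b : Module.Basis (Fin n) K B) (v : ℕ → B), (∀ i : Fin n, v i = b i) →
        b.repr (p.2 v) k = structConst stB b s k) := by
    rcases s with ⟨i, j⟩ | i
    · exact ⟨x i * x j, polyPairs.mul_mem (hx i) (hx j),
        fun a v hv => by simp [x, hv, structConst], fun a v hv => by simp [x, hv, structConst]⟩
    · exact ⟨_, polyPairs.star_mem hA1 hA2 hB1 hB2 (hx i),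
        fun a v hv => by simp [x, hv, structConst], fun a v hv => by simp [x, hv, structConst]⟩
  let w : Fin n → ((ℕ → A) → A) × ((ℕ → B) → B) := Function.update x k p
  have hw : ∀ i, w i ∈ polyPairs stA stB := fun i => by
    by_cases hi : i = k
    · subst hi; simpa [w] using hp
    · simpa [w, hi] using hx i
  refine ⟨_, Submodule.subset_span ⟨w, hw, rfl⟩, fun a v hv => ?_, fun b v hv => ?_⟩
  · have : (fun i => (w i).1 v) = Function.update a k (p.1 v) := by
      funext i
      by_cases hi : i = k
      · subst hi; simp [w]
      · simp [w, hi, x, hv]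
    rw [← hpA a v hv, ← Module.Basis.det_update, ← this]
  · have : (fun i => (w i).2 v) = Function.update b k (p.2 v) := by
      funext i
      by_cases hi : i = k
      · subst hi; simp [w]
      · simp [w, hi, x, hv]
    rw [← hpB b v hv, ← Module.Basis.det_update, ← this]

/-- The pair of determinants of the first `n` variables. -/
noncomputable def coordDet (bA : Module.Basis (Fin n) K A) (bB : Module.Basis (Fin n) K B) :
    ((ℕ → A) → K) × ((ℕ → B) → K) :=
  (fun v => bA.det fun i => v i, fun v => bB.det fun i => v i)

theorem coordDet_mem (bA : Module.Basis (Fin n) K A) (bB : Module.Basis (Fin n) K B) :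
    coordDet bA bB ∈ detPairs stA stB bA bB :=
  Submodule.subset_span ⟨fun i => (fun v => v i, fun v => v i),
    fun i => polyPairs.coord_mem i, rfl⟩

theorem exists_mem_detPairs_pow
    (hA1 : ∀ a, stA (stA a) = a) (hA2 : ∀ a b, stA (a * b) = stA b * stA a)
    (hB1 : ∀ a, stB (stB a) = a) (hB2 : ∀ a b, stB (a * b) = stB b * stB a)
    (bA : Module.Basis (Fin n) K A) (bB : Module.Basis (Fin n) K B)
    (Q : MvPolynomial (((Fin n × Fin n) ⊕ Fin n) × Fin n) K) :
    ∃ N, ∃ q ∈ detPairs stA stB bA bB ^ N,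
      (∀ (a : Module.Basis (Fin n) K A) (v : ℕ → A), (∀ i : Fin n, v i = a i) →
        q.1 v = bA.det a ^ N * MvPolynomial.eval (fun s => structConst stA a s.1 s.2) Q) ∧
      (∀ (b : Module.Basis (Fin n) K B) (v : ℕ → B), (∀ i : Fin n, v i = b i) →
        q.2 v = bB.det b ^ N * MvPolynomial.eval (fun s => structConst stB b s.1 s.2) Q) := by
  have hD : ∀ N, coordDet bA bB ^ N ∈ detPairs stA stB bA bB ^ N :=
    fun N => Submodule.pow_mem_pow _ (coordDet_mem bA bB) N
  induction Q using MvPolynomial.induction_on with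
  | C c =>
    refine ⟨0, algebraMap K _ c, ?_, by simp, by simp⟩
    rw [pow_zero]
    exact Submodule.algebraMap_mem c
  | add Q₁ Q₂ h₁ h₂ =>
    obtain ⟨N₁, q₁, hq₁, hA₁, hB₁⟩ := h₁
    obtain ⟨N₂, q₂, hq₂, hA₂, hB₂⟩ := h₂
    refine ⟨N₁ + N₂, q₁ * coordDet bA bB ^ N₂ + coordDet bA bB ^ N₁ * q₂, ?_,
      fun a v hv => ?_, fun b v hv => ?_⟩
    · rw [pow_add]
      exact add_mem (Submodule.mul_mem_mul hq₁ (hD _)) (Submodule.mul_mem_mul (hD _) hq₂)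
    · simp [hA₁ a v hv, hA₂ a v hv, coordDet, hv]
      ring
    · simp [hB₁ b v hv, hB₂ b v hv, coordDet, hv]
      ring
  | mul_X Q s h =>
    obtain ⟨N, q, hq, hA, hB⟩ := h
    obtain ⟨r, hr, hrA, hrB⟩ := exists_mem_detPairs hA1 hA2 hB1 hB2 bA bB s.1 s.2
    refine ⟨N + 1, q * r, ?_, fun a v hv => ?_, fun b v hv => ?_⟩
    · rw [pow_succ]
      exact Submodule.mul_mem_mul hq hr
    · simp [hA a v hv, hrA a v hv]
      ring
    · simp [hB b v hv, hrB b v hv]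
      ring

/-- Polynomial relations between structure constants pass from `A` to `B` if all identities do. -/
theorem eval_structConst_eq_zero [IsAlgClosed K] [FiniteDimensional K B]
    (hA1 : ∀ a, stA (stA a) = a) (hA2 : ∀ a b, stA (a * b) = stA b * stA a)
    (hB1 : ∀ a, stB (stB a) = a) (hB2 : ∀ a b, stB (a * b) = stB b * stB a)
    (hBs : IsStarSimple stB) (h : ∀ f, IsStarPI stA f → IsStarPI stB f)
    (bA : Module.Basis (Fin n) K A)
    (Q : MvPolynomial (((Fin n × Fin n) ⊕ Fin n) × Fin n) K)
    (hQ : ∀ a : Module.Basis (Fin n) K A,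
      MvPolynomial.eval (fun s => structConst stA a s.1 s.2) Q = 0)
    (b : Module.Basis (Fin n) K B) :
    MvPolynomial.eval (fun s => structConst stB b s.1 s.2) Q = 0 := by
  obtain ⟨N, q, hq, hqA, hqB⟩ := exists_mem_detPairs_pow hA1 hA2 hB1 hB2 bA b Q
  let v : ℕ → B := fun i => if hi : i < n then b ⟨i, hi⟩ else 0
  have hv : ∀ i : Fin n, v i = b i := fun i => by simp [v]
  have hmem := Submodule.mul_mem_mul hq (coordDet_mem (stA := stA) (stB := stB) bA b)
  rw [← pow_succ] at hmem
  have key := detPairs_pow_snd_eq_zero hA1 hA2 hB1 hB2 hBs h bA b b hv hmem (funext fun u => ?_)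
  · simpa [hqB b v hv, coordDet, hv, b.det_self] using key
  · by_cases hu : IsUnit (bA.det fun i : Fin n => u i)
    · obtain ⟨hli, hsp⟩ := (Module.Basis.is_basis_iff_det bA).2 hu
      simp [hqA (.mk hli hsp.ge) u (by simp), hQ]
    · have : bA.det (fun i : Fin n => u i) = 0 := by simpa using hu
      simp [coordDet, this]

end StructureConstants

section BasisRing

variable {K A B C D : Type*} [Field K]
  [NonUnitalNonAssocRing A] [Module K A] [NonUnitalNonAssocRing B] [Module K B]
  [CommRing C] [Algebra K C] [CommRing D] [Algebra K D] {n : ℕ}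

/-- The structure constants after a change of basis with transition matrices `G` and `H`. -/
noncomputable def transformedConst (st : A →ₗ[K] A) (a : Module.Basis (Fin n) K A)
    (G H : Fin n → Fin n → C) : (Fin n × Fin n) ⊕ Fin n → Fin n → C
  | .inl (i, j), k => ∑ p, ∑ q, ∑ r, structConst st a (.inl (p, q)) r • (G i p * G j q * H r k)
  | .inr i, k => ∑ p, ∑ r, structConst st a (.inr p) r • (G i p * H r k)

theorem map_transformedConst (st : A →ₗ[K] A) (a : Module.Basis (Fin n) K A)
    (G H : Fin n → Fin n → C) (φ : C →ₐ[K] D) (s : (Fin n × Fin n) ⊕ Fin n) (k : Fin n) :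
    φ (transformedConst st a G H s k) =
      transformedConst st a (fun i j => φ (G i j)) (fun i j => φ (H i j)) s k := by
  rcases s with ⟨i, j⟩ | i <;> simp [transformedConst]

theorem repr_apply_eq_sum (a v : Module.Basis (Fin n) K A) (x : A) (k : Fin n) :
    v.repr x k = ∑ r, a.repr x r * v.repr (a r) k := by
  have : v.repr x k = v.repr (∑ r, a.repr x r • a r) k := by rw [a.sum_repr]
  simpa only [map_sum, map_smul, Finsupp.coe_finsetSum, Finset.sum_apply, Finsupp.smul_apply,
    smul_eq_mul] using this

theorem structConst_eq_transformedConst [SMulCommClass K A A] [IsScalarTower K A A]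
    (st : A →ₗ[K] A) (a v : Module.Basis (Fin n) K A) (s : (Fin n × Fin n) ⊕ Fin n) (k : Fin n) :
    structConst st v s k =
      transformedConst st a (fun i j => a.repr (v i) j) (fun i j => v.repr (a i) j) s k := by
  rcases s with ⟨i, j⟩ | i
  · change v.repr (v i * v j) k = ∑ p, ∑ q, ∑ r, a.repr (a p * a q) r • _
    conv_lhs => rw [← a.sum_repr (v i), ← a.sum_repr (v j), Finset.sum_mul_sum]
    simp only [map_sum, Finsupp.coe_finsetSum, Finset.sum_apply, smul_mul_smul_comm, map_smul,
      Finsupp.smul_apply]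
    refine Finset.sum_congr rfl fun p _ => Finset.sum_congr rfl fun q _ => ?_
    rw [repr_apply_eq_sum a v, Finset.smul_sum]
    exact Finset.sum_congr rfl fun r _ => by simp only [smul_eq_mul]; ring
  · change v.repr (st (v i)) k = ∑ p, ∑ r, a.repr (st (a p)) r • _
    conv_lhs => rw [← a.sum_repr (v i)]
    simp only [map_sum, Finsupp.coe_finsetSum, Finset.sum_apply, map_smul, Finsupp.smul_apply]
    refine Finset.sum_congr rfl fun p _ => ?_
    rw [repr_apply_eq_sum a v, Finset.smul_sum]
    exact Finset.sum_congr rfl fun r _ => by simp only [smul_eq_mul]; ring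

/-- The algebra of functions on the set of bases generated by the entries of the transition
matrices from and to a fixed basis. -/
def basisRing (a : Module.Basis (Fin n) K A) : Subalgebra K (Module.Basis (Fin n) K A → K) :=
  Algebra.adjoin K (Set.range (fun (s : Fin n × Fin n) v => a.repr (v s.1) s.2) ∪
    Set.range fun (s : Fin n × Fin n) v => v.repr (a s.1) s.2)

namespace basisRing

instance (a : Module.Basis (Fin n) K A) : Algebra.FiniteType K (basisRing a) :=
  (Subalgebra.fg_iff_finiteType _).1 <|
    Subalgebra.fg_def.2 ⟨_, (Set.finite_range _).union (Set.finite_range _), rfl⟩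

/-- The transition matrix to the fixed basis. -/
noncomputable def toMatrix (a : Module.Basis (Fin n) K A) (i j : Fin n) : basisRing a :=
  ⟨fun v => a.repr (v i) j, Algebra.subset_adjoin <| .inl ⟨(i, j), rfl⟩⟩

/-- The transition matrix from the fixed basis. -/
noncomputable def invMatrix (a : Module.Basis (Fin n) K A) (i j : Fin n) : basisRing a :=
  ⟨fun v => v.repr (a i) j, Algebra.subset_adjoin <| .inr ⟨(i, j), rfl⟩⟩

theorem toMatrix_mul_invMatrix (a : Module.Basis (Fin n) K A) :
    (Matrix.of (toMatrix a) * Matrix.of (invMatrix a) : Matrix _ _ (basisRing a)) = 1 := by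
  ext i k v
  have h1 : (((1 : Matrix (Fin n) (Fin n) (basisRing a)) i k : basisRing a) :
      Module.Basis (Fin n) K A → K) v = v.repr (v i) k := by
    rw [v.repr_self, Matrix.one_apply, Finsupp.single_apply]
    split_ifs <;> rfl
  rw [h1, repr_apply_eq_sum a v]
  simp [Matrix.mul_apply, toMatrix, invMatrix]

/-- Polynomials in the structure constants, as functions on the set of bases. -/
noncomputable def constHom (st : A →ₗ[K] A) (a : Module.Basis (Fin n) K A) :
    MvPolynomial (((Fin n × Fin n) ⊕ Fin n) × Fin n) K →ₐ[K] basisRing a :=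
  MvPolynomial.aeval fun s => transformedConst st a (toMatrix a) (invMatrix a) s.1 s.2

variable [SMulCommClass K A A] [IsScalarTower K A A]

theorem constHom_apply (st : A →ₗ[K] A) (a : Module.Basis (Fin n) K A)
    (Q : MvPolynomial (((Fin n × Fin n) ⊕ Fin n) × Fin n) K) (v : Module.Basis (Fin n) K A) :
    (constHom st a Q : Module.Basis (Fin n) K A → K) v =
      MvPolynomial.eval (fun s => structConst st v s.1 s.2) Q := by
  let e : basisRing a →ₐ[K] K := (Pi.evalAlgHom K _ v).comp (basisRing a).val
  change e.comp (constHom st a) Q = MvPolynomial.aeval _ Q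
  congr 1
  refine MvPolynomial.algHom_ext fun s => ?_
  rw [AlgHom.comp_apply, constHom, MvPolynomial.aeval_X, MvPolynomial.aeval_X,
    map_transformedConst, structConst_eq_transformedConst st a v]
  rfl

theorem constHom_eq_zero_iff (st : A →ₗ[K] A) (a : Module.Basis (Fin n) K A)
    (Q : MvPolynomial (((Fin n × Fin n) ⊕ Fin n) × Fin n) K) :
    constHom st a Q = 0 ↔ ∀ v : Module.Basis (Fin n) K A,
      MvPolynomial.eval (fun s => structConst st v s.1 s.2) Q = 0 := by
  simp only [← constHom_apply st a]
  exact Subtype.ext_iff.trans funext_iff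

/-- The `K`-points of the spectrum of `basisRing a` are given by bases. -/
theorem exists_basis_structConst_eq (st : A →ₗ[K] A) (a : Module.Basis (Fin n) K A)
    (χ : basisRing a →ₐ[K] K) :
    ∃ v : Module.Basis (Fin n) K A, ∀ s,
      χ (constHom st a (MvPolynomial.X s)) = structConst st v s.1 s.2 := by
  let G : Matrix (Fin n) (Fin n) K := (Matrix.of (toMatrix a)).map χ
  let H : Matrix (Fin n) (Fin n) K := (Matrix.of (invMatrix a)).map χ
  have hGH : G * H = 1 := by
    rw [← Matrix.map_mul, toMatrix_mul_invMatrix, Matrix.map_one _ (map_zero χ) (map_one χ)]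
  have hHG : H * G = 1 := mul_eq_one_comm.1 hGH
  let w : Fin n → A := fun i => ∑ j, G i j • a j
  have hw : ∀ r, ∑ k, H r k • w k = a r := fun r => by
    have : ∀ j, ∑ k, H r k * G k j = (1 : Matrix (Fin n) (Fin n) K) r j := fun j => by
      rw [← hHG, Matrix.mul_apply]
    simp only [w, Finset.smul_sum, smul_smul]
    rw [Finset.sum_comm]
    simp [← Finset.sum_smul, this, Matrix.one_apply]
  have hsp : ⊤ ≤ Submodule.span K (Set.range w) := by
    rw [← a.span_eq, Submodule.span_le]
    rintro _ ⟨r, rfl⟩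
    rw [SetLike.mem_coe, ← hw r]
    exact sum_mem fun k _ => Submodule.smul_mem _ _ (Submodule.subset_span ⟨k, rfl⟩)
  let v := basisOfTopLeSpanOfCardEqFinrank w hsp (Module.finrank_eq_card_basis a).symm
  have hv : ∀ i, v i = w i := fun i => by simp [v]
  refine ⟨v, fun s => ?_⟩
  rw [constHom, MvPolynomial.aeval_X, map_transformedConst, structConst_eq_transformedConst st a v]
  congr 1 <;> funext i j
  · rw [hv]
    simp [w, Finsupp.single_apply, G]
  · rw [← hw i]
    simp_rw [← hv]
    simp [Finsupp.single_apply, H]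

end basisRing

end BasisRing

/-- Equal structure constants give an isomorphism of algebras with involution. -/
theorem exists_equiv_of_structConst_eq {K A B : Type*} [Field K]
    [NonUnitalNonAssocRing A] [Module K A] [SMulCommClass K A A] [IsScalarTower K A A]
    [NonUnitalNonAssocRing B] [Module K B] [SMulCommClass K B B] [IsScalarTower K B B]
    {stA : A →ₗ[K] A} {stB : B →ₗ[K] B} {n : ℕ}
    (v : Module.Basis (Fin n) K A) (w : Module.Basis (Fin n) K B)
    (h : ∀ s k, structConst stA v s k = structConst stB w s k) :
    ∃ φ : A ≃ₗ[K] B, (∀ a b : A, φ (a * b) = φ a * φ b) ∧ ∀ a : A, φ (stA a) = stB (φ a) := by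
  let φ : A ≃ₗ[K] B := v.equiv w (Equiv.refl _)
  have hφv : ∀ i, φ (v i) = w i := fun i => by simp [φ]
  have hφ : ∀ x y, (∀ k, v.repr x k = w.repr y k) → φ x = y := fun x y hxy => by
    rw [← v.sum_repr x, ← w.sum_repr y]
    simp [hφv, hxy]
  have hmul : (LinearMap.mul K A).compr₂ φ.toLinearMap =
      (LinearMap.mul K B).compl₁₂ φ.toLinearMap φ.toLinearMap :=
    v.ext fun i => v.ext fun j => by
      simpa [hφv] using hφ (v i * v j) (w i * w j) (h (.inl (i, j)))
  have hst : φ.toLinearMap ∘ₗ stA = stB ∘ₗ φ.toLinearMap :=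
    v.ext fun i => by simpa [hφv] using hφ (stA (v i)) (stB (w i)) (h (.inr i))
  exact ⟨φ, fun a b => LinearMap.congr_fun₂ hmul a b, fun a => LinearMap.congr_fun hst a⟩

theorem starSimple_same_starIdentities_isomorphic
    (K A B : Type*) [Field K] [IsAlgClosed K]
    [NonUnitalNonAssocRing A] [Module K A] [SMulCommClass K A A] [IsScalarTower K A A]
    [FiniteDimensional K A]
    [NonUnitalNonAssocRing B] [Module K B] [SMulCommClass K B B] [IsScalarTower K B B]
    [FiniteDimensional K B]
    (stA : A →ₗ[K] A) (hA1 : ∀ a : A, stA (stA a) = a)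
    (hA2 : ∀ a b : A, stA (a * b) = stA b * stA a)
    (stB : B →ₗ[K] B) (hB1 : ∀ a : B, stB (stB a) = a)
    (hB2 : ∀ a b : B, stB (a * b) = stB b * stB a)
    (hAs : IsStarSimple stA) (hBs : IsStarSimple stB)
    (hsame : ∀ f : FreeNonUnitalNonAssocAlgebra K (ℕ × Bool),
      IsStarPI stA f ↔ IsStarPI stB f) :
    ∃ φ : A ≃ₗ[K] B, (∀ a b : A, φ (a * b) = φ a * φ b) ∧
      ∀ a : A, φ (stA a) = stB (φ a) := by
  have hle₁ := finrank_le_of_starIdentities hA1 hA2 hB1 hB2 hBs fun f => (hsame f).1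
  have hle₂ := finrank_le_of_starIdentities hB1 hB2 hA1 hA2 hAs fun f => (hsame f).2
  let a : Module.Basis (Fin (Module.finrank K A)) K A := Module.finBasis K A
  let b : Module.Basis (Fin (Module.finrank K A)) K B :=
    Module.finBasisOfFinrankEq K B (hle₁.antisymm hle₂)
  have : Nonempty (Module.Basis (Fin (Module.finrank K A)) K A) := ⟨a⟩
  obtain ⟨χ, ψ, h⟩ := exists_algHom_comp_eq_of_ker_eq (basisRing.constHom stA a)
    (basisRing.constHom stB b) fun Q => by
      rw [basisRing.constHom_eq_zero_iff, basisRing.constHom_eq_zero_iff]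
      exact ⟨fun hQ => eval_structConst_eq_zero hA1 hA2 hB1 hB2 hBs (fun f => (hsame f).1) a Q hQ,
        fun hQ => eval_structConst_eq_zero hB1 hB2 hA1 hA2 hAs (fun f => (hsame f).2) b Q hQ⟩
  obtain ⟨v, hv⟩ := basisRing.exists_basis_structConst_eq stA a χ
  obtain ⟨w, hw⟩ := basisRing.exists_basis_structConst_eq stB b ψ
  have hvw : ∀ s k, structConst stA v s k = structConst stB w s k := fun s k => by
    rw [← hv (s, k), ← hw (s, k)]
    exact DFunLike.congr_fun h _
  exact exists_equiv_of_structConst_eq v w hvw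
end

section
/- Let K be an algebraically closed field and let (A, *) and (B, *) be finite-dimensional superalgebras with involution over K, each simple as a superalgebra with involution. If A and B satisfy the same graded polynomial identities with involution, then there is an isomorphism of superalgebras with involution between A and B, i.e., a bijective K-linear multiplicative map φ : A → B with φ(A_g) = B_g for g ∈ ℤ/2 and φ(a*) = φ(a)* for all a ∈ A. -/
/-- `I` is an invariant ideal of the superalgebra with involution `(A, 𝒜, st)`:
a two-sided ideal with `I = (I ∩ A_0) ⊕ (I ∩ A_1)` and `I* ⊆ I`. -/
def IsInvariantIdeal {K A : Type*} [Field K] [NonUnitalNonAssocRing A] [Module K A]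
    (𝒜 : ZMod 2 → Submodule K A) (st : A →ₗ[K] A) (I : Submodule K A) : Prop :=
  IsIdeal I ∧ (I = ⨆ g, I ⊓ 𝒜 g) ∧ (∀ a ∈ I, st a ∈ I)

/-- `(A, 𝒜, st)` is simple as a superalgebra with involution. -/
def IsSuperStarSimple {K A : Type*} [Field K] [NonUnitalNonAssocRing A] [Module K A]
    (𝒜 : ZMod 2 → Submodule K A) (st : A →ₗ[K] A) : Prop :=
  (∃ a b : A, a * b ≠ 0) ∧
    ∀ I : Submodule K A, IsInvariantIdeal 𝒜 st I → I = ⊥ ∨ I = ⊤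

/-- `f`, an element of the free ℤ/2-graded nonassociative algebra with involution (the
`K`-vector space with basis the free magma on `ℕ × ZMod 2 × Bool`, where `(x, g, false)`
plays the role of the generator `x^{(g)}` and `(x, g, true)` that of `(x^{(g)})*`), is a
graded polynomial identity with involution of `(A, 𝒜, st)`: for every assignment
`e : ℕ × ZMod 2 → A` with `e (x, g) ∈ A_g`, evaluating `x^{(g)} ↦ e (x, g)` and
`(x^{(g)})* ↦ st (e (x, g))` kills `f`. -/
def IsSuperStarPI {K A : Type*} [Field K] [NonUnitalNonAssocRing A] [Module K A]
    [SMulCommClass K A A] [IsScalarTower K A A]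
    (𝒜 : ZMod 2 → Submodule K A) (st : A →ₗ[K] A)
    (f : FreeNonUnitalNonAssocAlgebra K (ℕ × ZMod 2 × Bool)) : Prop :=
  ∀ e : ℕ × ZMod 2 → A, (∀ x g, e (x, g) ∈ 𝒜 g) →
    FreeNonUnitalNonAssocAlgebra.lift K
      (fun p : ℕ × ZMod 2 × Bool =>
        if p.2.2 then st (e (p.1, p.2.1)) else e (p.1, p.2.1)) f = 0

section SameIdentities

open Module TensorProduct

universe u

/-- Every maximal ideal of a finitely generated algebra over an algebraically closed field is the
kernel of a point. -/
theorem exists_algHom_ker_eq_of_isMaximal {K T : Type*} [Field K] [IsAlgClosed K]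
    [CommRing T] [Algebra K T] [Algebra.FiniteType K T] (m : Ideal T) [m.IsMaximal] :
    ∃ ψ : T →ₐ[K] K, ∀ r, ψ r = 0 ↔ r ∈ m := by
  let := Ideal.Quotient.field m
  have : Algebra.FiniteType K (T ⧸ m) :=
    .of_surjective (Ideal.Quotient.mkₐ K m) (Ideal.Quotient.mkₐ_surjective K m)
  have := finite_of_finite_type_of_isJacobsonRing K (T ⧸ m)
  let ε : K ≃ₐ[K] (T ⧸ m) := AlgEquiv.ofBijective (Algebra.ofId _ _)
    (IsAlgClosed.algebraMap_bijective_of_isIntegral (k := K))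
  refine ⟨ε.symm.toAlgHom.comp (Ideal.Quotient.mkₐ K m), fun r ↦ ?_⟩
  exact (map_eq_zero_iff ε.symm ε.symm.injective).trans Ideal.Quotient.eq_zero_iff_mem

/-- Two finitely generated domains over an algebraically closed field with families of elements
satisfying the same polynomial relations have points at which these families agree. -/
theorem exists_algHoms_agree_of_same_relations {K T₁ T₂ κ : Type*} [Field K] [IsAlgClosed K]
    [CommRing T₁] [IsDomain T₁] [Algebra K T₁] [Algebra.FiniteType K T₁]
    [CommRing T₂] [IsDomain T₂] [Algebra K T₂] [Algebra.FiniteType K T₂]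
    (s₁ : κ → T₁) (s₂ : κ → T₂)
    (h : ∀ p : MvPolynomial κ K, MvPolynomial.aeval s₁ p = 0 ↔ MvPolynomial.aeval s₂ p = 0) :
    ∃ (ψ₁ : T₁ →ₐ[K] K) (ψ₂ : T₂ →ₐ[K] K), ∀ q, ψ₁ (s₁ q) = ψ₂ (s₂ q) := by
  let I := RingHom.ker (MvPolynomial.aeval (R := K) s₁)
  let R := MvPolynomial κ K ⧸ I
  let f₁ : R →ₐ[K] T₁ := Ideal.Quotient.liftₐ I (MvPolynomial.aeval s₁) fun _ ha ↦ ha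
  let f₂ : R →ₐ[K] T₂ := Ideal.Quotient.liftₐ I (MvPolynomial.aeval s₂) fun a ha ↦ (h a).1 ha
  have hf₁ : Function.Injective f₁ := by
    rw [injective_iff_map_eq_zero]
    intro a
    obtain ⟨a, rfl⟩ := Ideal.Quotient.mk_surjective a
    exact fun ha ↦ Ideal.Quotient.eq_zero_iff_mem.2 ha
  have hf₂ : Function.Injective f₂ := by
    rw [injective_iff_map_eq_zero]
    intro a
    obtain ⟨a, rfl⟩ := Ideal.Quotient.mk_surjective a
    exact fun ha ↦ Ideal.Quotient.eq_zero_iff_mem.2 ((h a).2 ha)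
  let : Algebra R T₁ := f₁.toRingHom.toAlgebra
  let : Algebra R T₂ := f₂.toRingHom.toAlgebra
  have : IsScalarTower K R T₁ := .of_algebraMap_eq fun r ↦ (f₁.commutes r).symm
  have : IsScalarTower K R T₂ := .of_algebraMap_eq fun r ↦ (f₂.commutes r).symm
  have : Nontrivial (T₁ ⊗[R] T₂) :=
    Algebra.TensorProduct.nontrivial_of_algebraMap_injective_of_isDomain R T₁ T₂ hf₁ hf₂
  let Φ : T₁ ⊗[K] T₂ →ₐ[K] T₁ ⊗[R] T₂ := Algebra.TensorProduct.lift
    Algebra.TensorProduct.includeLeft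
    (Algebra.TensorProduct.includeRight.restrictScalars K) fun _ _ ↦ Commute.all _ _
  obtain ⟨m, hm, hle⟩ := Ideal.exists_le_maximal (RingHom.ker Φ) (RingHom.ker_ne_top Φ)
  have : Algebra.FiniteType K (T₁ ⊗[K] T₂) := .trans (S := T₁) inferInstance inferInstance
  obtain ⟨Ψ, hΨ⟩ := exists_algHom_ker_eq_of_isMaximal (K := K) m
  refine ⟨Ψ.comp Algebra.TensorProduct.includeLeft, Ψ.comp Algebra.TensorProduct.includeRight,
    fun q ↦ ?_⟩
  rw [← sub_eq_zero, AlgHom.comp_apply, AlgHom.comp_apply, ← map_sub]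
  refine (hΨ _).2 (hle ?_)
  rw [RingHom.mem_ker, map_sub, sub_eq_zero]
  have h₁ : algebraMap R T₁ (Ideal.Quotient.mk I (.X q)) = s₁ q := MvPolynomial.aeval_X s₁ q
  have h₂ : algebraMap R T₂ (Ideal.Quotient.mk I (.X q)) = s₂ q := MvPolynomial.aeval_X s₂ q
  have := Algebra.TensorProduct.tmul_one_eq_one_tmul (A := T₁) (B := T₂)
    (Ideal.Quotient.mk I (.X q) : R)
  rw [h₁, h₂] at this
  simpa [Φ] using this

/-- An element of a finitely generated domain over an algebraically closed field is zero as soon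
as it vanishes at all points. -/
theorem eq_zero_of_forall_algHom_eq_zero {K T : Type*} [Field K] [IsAlgClosed K]
    [CommRing T] [IsDomain T] [Algebra K T] [Algebra.FiniteType K T] {r : T}
    (h : ∀ ψ : T →ₐ[K] K, ψ r = 0) : r = 0 := by
  have : IsJacobsonRing T := isJacobsonRing_of_finiteType (A := K)
  have hJ : (⊥ : Ideal T).jacobson = ⊥ :=
    IsJacobsonRing.out ‹_› (Ideal.isPrime_bot (α := T)).isRadical
  rw [← Ideal.mem_bot, ← hJ, Ideal.jacobson, Ideal.mem_sInf]
  rintro m ⟨-, hm⟩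
  obtain ⟨ψ, hψ⟩ := exists_algHom_ker_eq_of_isMaximal (K := K) m
  exact (hψ r).1 (h ψ)

section StructureConstants

variable {K A S ι : Type*} [Field K] [NonUnitalNonAssocRing A] [Module K A]

/-- The coordinates, in the basis `b`, of all products of two basis elements and of all images of
basis elements under the operators `op s`. -/
noncomputable def structureConstants (op : S → End K A) (b : Basis ι K A) :
    (ι × ι × ι) ⊕ (S × ι × ι) → K :=
  Sum.elim (fun q ↦ b.repr (b q.1 * b q.2.1) q.2.2) (fun q ↦ b.repr (op q.1 (b q.2.1)) q.2.2)

/-- Structure constants after the base change with matrix `g` and inverse matrix `h`. -/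
noncomputable def changedConstants [Fintype ι] {T : Type*} [CommRing T] [Algebra K T]
    (c : (ι × ι × ι) ⊕ (S × ι × ι) → K) (g h : Matrix ι ι T) :
    (ι × ι × ι) ⊕ (S × ι × ι) → T :=
  Sum.elim
    (fun q ↦ ∑ i, ∑ j, ∑ k,
      g q.1 i * g q.2.1 j * algebraMap K T (c (.inl (i, j, k))) * h k q.2.2)
    (fun q ↦ ∑ i, ∑ k, g q.2.1 i * algebraMap K T (c (.inr (q.1, i, k))) * h k q.2.2)

theorem map_changedConstants [Fintype ι] {T T' : Type*} [CommRing T] [Algebra K T] [CommRing T']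
    [Algebra K T'] (ψ : T →ₐ[K] T') (c : (ι × ι × ι) ⊕ (S × ι × ι) → K) (g h : Matrix ι ι T)
    (q : (ι × ι × ι) ⊕ (S × ι × ι)) :
    ψ (changedConstants c g h q) = changedConstants c (g.map ψ) (h.map ψ) q := by
  rcases q with q | q <;> simp [changedConstants]

variable [SMulCommClass K A A] [IsScalarTower K A A]

theorem structureConstants_eq_changedConstants [Fintype ι] (op : S → End K A)
    (a b : Basis ι K A) (q : (ι × ι × ι) ⊕ (S × ι × ι)) :
    structureConstants op b q = changedConstants (structureConstants op a)
      (fun i j ↦ a.repr (b i) j) (fun i j ↦ b.repr (a i) j) q := by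
  have hb (i : ι) : b i = ∑ j, a.repr (b i) j • a j := (a.sum_repr _).symm
  have hr (v : A) (k : ι) : b.repr v k = ∑ c, a.repr v c * b.repr (a c) k := by
    have := congrArg (fun w ↦ b.repr w k) (a.sum_repr v)
    simp only [map_sum, map_smul, Finsupp.finsetSum_apply, Finsupp.smul_apply,
      smul_eq_mul] at this
    exact this.symm
  rcases q with ⟨i, j, k⟩ | ⟨s, i, k⟩
  · simp only [structureConstants, changedConstants, Sum.elim_inl, Algebra.algebraMap_self,
      RingHom.id_apply]
    conv_lhs => rw [hb i, hb j, Finset.sum_mul_sum]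
    simp only [map_sum, Finsupp.finsetSum_apply, smul_mul_smul_comm, map_smul, Finsupp.smul_apply,
      smul_eq_mul]
    refine Finset.sum_congr rfl fun i' _ ↦ Finset.sum_congr rfl fun j' _ ↦ ?_
    rw [hr, Finset.mul_sum]
    exact Finset.sum_congr rfl fun _ _ ↦ by ring
  · simp only [structureConstants, changedConstants, Sum.elim_inr, Algebra.algebraMap_self,
      RingHom.id_apply]
    conv_lhs => rw [hb i]
    simp only [map_sum, Finsupp.finsetSum_apply, map_smul, Finsupp.smul_apply, smul_eq_mul]
    refine Finset.sum_congr rfl fun i' _ ↦ ?_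
    rw [hr, Finset.mul_sum]
    exact Finset.sum_congr rfl fun _ _ ↦ by ring

/-- The coordinate ring of the general linear group carries generic structure constants, whose
specializations are exactly the structure constants in the various bases. -/
theorem exists_generic_structureConstants {K : Type u} {A : Type*} {S ι : Type} [Field K]
    [NonUnitalNonAssocRing A] [Module K A] [SMulCommClass K A A] [IsScalarTower K A A]
    [Fintype ι] (op : S → End K A) (a : Basis ι K A) :
    ∃ (T : Type u) (_ : CommRing T) (_ : IsDomain T) (_ : Algebra K T) (_ : Algebra.FiniteType K T)
      (s : (ι × ι × ι) ⊕ (S × ι × ι) → T),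
      (∀ ψ : T →ₐ[K] K, ∃ b : Basis ι K A, ∀ q, ψ (s q) = structureConstants op b q) ∧
      ∀ b : Basis ι K A, ∃ ψ : T →ₐ[K] K, ∀ q, ψ (s q) = structureConstants op b q := by
  classical
  let d : MvPolynomial (ι × ι) K := (Matrix.mvPolynomialX ι ι K).det
  have hd : d ≠ 0 := Matrix.det_mvPolynomialX_ne_zero ι K
  let T := Localization.Away d
  have hT : IsDomain T :=
    IsLocalization.isDomain_localization (powers_le_nonZeroDivisors_of_noZeroDivisors hd)
  have hFT : Algebra.FiniteType K T :=
    .trans (S := MvPolynomial (ι × ι) K) inferInstance (IsLocalization.finiteType_of_monoid_fg (.powers d) _)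
  let g : Matrix ι ι T := (Matrix.mvPolynomialX ι ι K).map (algebraMap _ T)
  have hg : IsUnit g.det := by
    have : g.det = algebraMap _ T d := ((algebraMap (MvPolynomial (ι × ι) K) T).map_det _).symm
    rw [this]
    exact IsLocalization.Away.algebraMap_isUnit d
  refine ⟨T, inferInstance, hT, inferInstance, hFT,
    changedConstants (structureConstants op a) g g⁻¹, fun ψ ↦ ?_, fun b ↦ ?_⟩
  · let G := g.map ψ
    let H := g⁻¹.map ψ
    have hGH : G * H = 1 := by
      simp only [G, H, ← Matrix.map_mul, Matrix.mul_nonsing_inv g hg]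
      simp
    have hHG : H * G = 1 := mul_eq_one_comm.1 hGH
    let φ : A ≃ₗ[K] A := LinearEquiv.ofLinearMap (Matrix.toLin a a G.transpose)
      (Matrix.toLin a a H.transpose)
      (by rw [← Matrix.toLin_mul, ← Matrix.transpose_mul, hHG]; simp)
      (by rw [← Matrix.toLin_mul, ← Matrix.transpose_mul, hGH]; simp)
    refine ⟨a.map φ, fun q ↦ ?_⟩
    rw [map_changedConstants, structureConstants_eq_changedConstants op a]
    congr 1
    · ext i j
      simp [φ, G, Matrix.toLin_self, Finsupp.single_apply]
    · ext i j
      simp [φ, H, Matrix.toLin_self, Finsupp.single_apply]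
  · let G : Matrix ι ι K := fun i j ↦ a.repr (b i) j
    let H : Matrix ι ι K := fun i j ↦ b.repr (a i) j
    have hGH : G * H = 1 := by
      ext i k
      have := congrArg (fun v ↦ b.repr v k) (a.sum_repr (b i))
      simp only [map_sum, map_smul, Finsupp.finsetSum_apply, Finsupp.smul_apply, smul_eq_mul,
        Basis.repr_self] at this
      rw [Matrix.mul_apply, this, Finsupp.single_apply, Matrix.one_apply]
    let ψ₀ : MvPolynomial (ι × ι) K →ₐ[K] K := MvPolynomial.aeval fun p ↦ G p.1 p.2
    have hX : (Matrix.mvPolynomialX ι ι K).map ψ₀ = G := by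
      ext i j; simp [ψ₀]
    have hψd : ψ₀ d = G.det := by
      rw [← hX]; exact ψ₀.toRingHom.map_det _
    have hu : IsUnit (ψ₀ d) := hψd ▸ (Matrix.isUnit_iff_isUnit_det G).1 (.of_mul_eq_one H hGH)
    let ψ : T →ₐ[K] K := IsLocalization.liftAlgHom (M := .powers d) (f := ψ₀) (by
      rintro ⟨_, n, rfl⟩
      simpa using hu.pow n)
    have hgG : g.map ψ = G := by
      rw [← hX]
      ext i j
      simp [g, ψ]
    refine ⟨ψ, fun q ↦ ?_⟩
    rw [map_changedConstants, structureConstants_eq_changedConstants op a, hgG]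
    congr 1
    have : G * g⁻¹.map ψ = 1 := by
      rw [← hgG, ← Matrix.map_mul, Matrix.mul_nonsing_inv g hg]
      simp
    exact (left_inv_eq_right_inv (mul_eq_one_comm.1 hGH) this).symm

theorem aeval_eq_zero_iff_of_generic {K A S ι T : Type*} [Field K] [IsAlgClosed K]
    [NonUnitalNonAssocRing A] [Module K A]
    [CommRing T] [IsDomain T] [Algebra K T] [Algebra.FiniteType K T] (op : S → End K A)
    (s : (ι × ι × ι) ⊕ (S × ι × ι) → T)
    (hs : ∀ ψ : T →ₐ[K] K, ∃ b : Basis ι K A, ∀ q, ψ (s q) = structureConstants op b q)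
    (hs' : ∀ b : Basis ι K A, ∃ ψ : T →ₐ[K] K, ∀ q, ψ (s q) = structureConstants op b q)
    (p : MvPolynomial ((ι × ι × ι) ⊕ (S × ι × ι)) K) :
    MvPolynomial.aeval s p = 0 ↔
      ∀ b : Basis ι K A, MvPolynomial.aeval (structureConstants op b) p = 0 := by
  refine ⟨fun hp b ↦ ?_, fun hp ↦ eq_zero_of_forall_algHom_eq_zero (K := K) fun ψ ↦ ?_⟩
  · obtain ⟨ψ, hψ⟩ := hs' b
    rw [← funext hψ, ← MvPolynomial.comp_aeval_apply, hp, map_zero]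
  · obtain ⟨b, hb⟩ := hs ψ
    rw [MvPolynomial.comp_aeval_apply, funext hb, hp b]

/-- Two algebras with operators whose structure constants satisfy the same polynomial equations
have bases with equal structure constants. -/
theorem exists_bases_of_same_equations {K A B : Type*} {S ι : Type} [Field K] [IsAlgClosed K]
    [NonUnitalNonAssocRing A] [Module K A] [SMulCommClass K A A] [IsScalarTower K A A]
    [NonUnitalNonAssocRing B] [Module K B] [SMulCommClass K B B] [IsScalarTower K B B]
    [Fintype ι] (opA : S → End K A) (opB : S → End K B)
    (a₀ : Basis ι K A) (b₀ : Basis ι K B)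
    (h : ∀ p : MvPolynomial ((ι × ι × ι) ⊕ (S × ι × ι)) K,
      (∀ a : Basis ι K A, MvPolynomial.aeval (structureConstants opA a) p = 0) ↔
      ∀ b : Basis ι K B, MvPolynomial.aeval (structureConstants opB b) p = 0) :
    ∃ (a : Basis ι K A) (b : Basis ι K B), structureConstants opA a = structureConstants opB b := by
  obtain ⟨T₁, _, _, _, _, s₁, h₁, h₁'⟩ := exists_generic_structureConstants opA a₀
  obtain ⟨T₂, _, _, _, _, s₂, h₂, h₂'⟩ := exists_generic_structureConstants opB b₀
  obtain ⟨ψ₁, ψ₂, hψ⟩ := exists_algHoms_agree_of_same_relations s₁ s₂ fun p ↦ by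
    rw [aeval_eq_zero_iff_of_generic opA s₁ h₁ h₁', aeval_eq_zero_iff_of_generic opB s₂ h₂ h₂', h]
  obtain ⟨a, ha⟩ := h₁ ψ₁
  obtain ⟨b, hb⟩ := h₂ ψ₂
  exact ⟨a, b, funext fun q ↦ by rw [← ha, ← hb, hψ]⟩

/-- Equal structure constants give an isomorphism of algebras with operators. -/
theorem exists_equiv_of_structureConstants_eq {K A B S ι : Type*} [Field K]
    [NonUnitalNonAssocRing A] [Module K A] [SMulCommClass K A A] [IsScalarTower K A A]
    [NonUnitalNonAssocRing B] [Module K B] [SMulCommClass K B B] [IsScalarTower K B B]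
    (opA : S → End K A) (opB : S → End K B) (a : Basis ι K A) (b : Basis ι K B)
    (h : structureConstants opA a = structureConstants opB b) :
    ∃ φ : A ≃ₗ[K] B, (∀ x y, φ (x * y) = φ x * φ y) ∧ ∀ s x, φ (opA s x) = opB s (φ x) := by
  let φ := a.equiv b (Equiv.refl ι)
  have hφ (i : ι) : φ (a i) = b i := by simp [φ]
  have hr (v : A) (k : ι) : b.repr (φ v) k = a.repr v k := by simp [φ, Basis.equiv]
  refine ⟨φ, fun x y ↦ ?_, fun s x ↦ ?_⟩
  · have : (LinearMap.mul K A).compr₂ φ.toLinearMap =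
        (LinearMap.mul K B).compl₁₂ φ.toLinearMap φ.toLinearMap := by
      refine LinearMap.ext_basis a a fun i j ↦ b.repr.injective (Finsupp.ext fun k ↦ ?_)
      simpa [hr, hφ, structureConstants] using congrFun h (.inl (i, j, k))
    exact LinearMap.congr_fun₂ this x y
  · have : φ.toLinearMap ∘ₗ opA s = opB s ∘ₗ φ.toLinearMap := by
      refine a.ext fun i ↦ b.repr.injective (Finsupp.ext fun k ↦ ?_)
      simpa [hr, hφ, structureConstants] using congrFun h (.inr (s, i, k))
    exact LinearMap.congr_fun this x

end StructureConstants

section Burnside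

variable {K A S : Type*} [Field K] [NonUnitalNonAssocRing A] [Module K A]
  [SMulCommClass K A A] [IsScalarTower K A A]

/-- **Burnside's theorem**: a subalgebra of endomorphisms of a nonzero finite-dimensional space over
an algebraically closed field without invariant subspaces contains all endomorphisms. -/
theorem subalgebra_eq_top_of_irreducible {K V : Type*} [Field K] [IsAlgClosed K] [AddCommGroup V]
    [Module K V] [FiniteDimensional K V] [Nontrivial V] (M : Subalgebra K (End K V))
    (h : ∀ I : Submodule K V, (∀ T ∈ M, ∀ v ∈ I, T v ∈ I) → I = ⊥ ∨ I = ⊤) : M = ⊤ := by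
  have : IsSimpleModule M V := by
    rw [isSimpleModule_iff]
    refine ⟨fun I ↦ ?_⟩
    refine (h (I.restrictScalars K) fun T hT v hv ↦ I.smul_mem (⟨T, hT⟩ : M) hv).imp ?_ ?_
    · exact (Submodule.restrictScalars_eq_bot_iff ..).1
    · exact (Submodule.restrictScalars_eq_top_iff ..).1
  rw [eq_top_iff]
  intro f _
  let f' : End (End M V) V :=
    { f with
      map_smul' := fun e v ↦ by
        obtain ⟨c, rfl⟩ :=
          (IsSimpleModule.algebraMap_end_bijective_of_isAlgClosed (A := M) (V := V) K).2 e
        exact f.map_smul c v }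
  let b := Module.finBasis K V
  obtain ⟨r, hr⟩ := jacobson_density (R := M) f' (Finset.univ.map ⟨b, b.injective⟩)
  have : f = r := b.ext fun i ↦ hr (b i) (by simp)
  exact this ▸ r.2

/-- The algebra of operators generated by all multiplications and the operators `op s`. -/
def multiplicationAlgebra (op : S → End K A) : Subalgebra K (End K A) :=
  Algebra.adjoin K (Set.range (LinearMap.mulLeft K) ∪ Set.range (LinearMap.mulRight K) ∪
    Set.range op)

theorem multiplicationAlgebra_eq_top [IsAlgClosed K] [FiniteDimensional K A] [Nontrivial A]
    (op : S → End K A)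
    (h : ∀ I : Submodule K A, (∀ a ∈ I, ∀ b, a * b ∈ I ∧ b * a ∈ I) →
      (∀ s, ∀ a ∈ I, op s a ∈ I) → I = ⊥ ∨ I = ⊤) :
    multiplicationAlgebra op = ⊤ := by
  refine subalgebra_eq_top_of_irreducible _ fun I hI ↦ h I (fun a ha b ↦ ⟨?_, ?_⟩) fun s a ha ↦ ?_
  · exact hI _ (Algebra.subset_adjoin (.inl (.inr ⟨b, rfl⟩))) a ha
  · exact hI _ (Algebra.subset_adjoin (.inl (.inl ⟨b, rfl⟩))) a ha
  · exact hI _ (Algebra.subset_adjoin (.inr ⟨s, rfl⟩)) a ha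

end Burnside

section Capelli

variable {n : ℕ}

/-- The Capelli-type alternating sum of products, in fixed order, of the entries of `q`. -/
def capelli {Q : Type*} [Ring Q] (q : Fin n → Fin n → Q) : Q :=
  ∑ σ : Equiv.Perm (Fin n), (Equiv.Perm.sign σ : ℤ) • (List.ofFn fun i ↦ q i (σ i)).prod

theorem map_capelli {Q Q' : Type*} [Ring Q] [Ring Q'] (f : Q →+* Q') (q : Fin n → Fin n → Q) :
    f (capelli q) = capelli fun i j ↦ f (q i j) := by
  simp [capelli, map_sum, map_list_prod, List.map_ofFn, Function.comp_def]

theorem capelli_eq_pair {X Y Q Q' : Type*} [Ring Q] [Ring Q']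
    (q : Fin n → Fin n → (X → Q) × (Y → Q')) :
    capelli q = (fun e ↦ capelli fun i j ↦ (q i j).1 e, fun e ↦ capelli fun i j ↦ (q i j).2 e) :=
  Prod.ext
    (funext fun e ↦ map_capelli ((Pi.evalRingHom (fun _ ↦ Q) e).comp (RingHom.fst _ _)) q)
    (funext fun e ↦ map_capelli ((Pi.evalRingHom (fun _ ↦ Q') e).comp (RingHom.snd _ _)) q)

theorem capelli_mem {K Q : Type*} [CommRing K] [Ring Q] [Algebra K Q] (M : Subalgebra K Q)
    {q : Fin n → Fin n → Q} (h : ∀ i j, q i j ∈ M) : capelli q ∈ M := by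
  refine sum_mem fun σ _ ↦ zsmul_mem (M.list_prod_mem fun x hx ↦ ?_) _
  obtain ⟨i, rfl⟩ := List.mem_ofFn.1 hx
  exact h _ _

/-- `capelli` as an alternating map. -/
noncomputable def capelliMap {K A Q : Type*} [Field K] [AddCommGroup A] [Module K A] [Ring Q]
    [Algebra K Q] (G : Fin n → A →ₗ[K] Q) : A [⋀^Fin n]→ₗ[K] Q :=
  MultilinearMap.alternatization
    ((MultilinearMap.mkPiAlgebraFin K n Q).compLinearMap G)

theorem capelliMap_apply {K A Q : Type*} [Field K] [AddCommGroup A] [Module K A] [Ring Q]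
    [Algebra K Q] (G : Fin n → A →ₗ[K] Q) (v : Fin n → A) :
    capelliMap G v = capelli fun i j ↦ G i (v j) := by
  simp [capelliMap, capelli, MultilinearMap.alternatization_apply, Units.smul_def]

theorem capelli_apply_of_diagonal {K V : Type*} [Field K] [AddCommGroup V] [Module K V]
    (q : Fin n → Fin n → End K V) (v : V) (h : ∀ i j, q i j v = if i = j then v else 0) :
    capelli q v = v := by
  have hfix (l : List (Fin n)) (σ : Equiv.Perm (Fin n)) :
      (l.map fun i ↦ q i (σ i)).prod v = if ∀ i ∈ l, i = σ i then v else 0 := by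
    induction l with
    | nil => simp
    | cons i l ih =>
      rw [List.map_cons, List.prod_cons, Module.End.mul_apply, ih]
      simp only [List.forall_mem_cons]
      by_cases hl : ∀ i ∈ l, i = σ i
      · simp only [if_pos hl, h, and_iff_left hl]
      · simp only [if_neg hl, map_zero, if_neg fun hil : i = σ i ∧ ∀ i ∈ l, i = σ i ↦ hl hil.2]
  simp only [capelli, LinearMap.sum_apply, LinearMap.smul_apply, List.ofFn_eq_map, hfix]
  rw [Finset.sum_eq_single 1]
  · simp
  · intro σ _ hσ
    rw [if_neg, smul_zero]
    exact fun h ↦ hσ (Equiv.ext fun i ↦ (h i (List.mem_finRange i)).symm)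
  · simp

end Capelli

section PolynomialPairs

variable {K A B S : Type*} {n : ℕ} [Field K]
  [NonUnitalNonAssocRing A] [Module K A] [NonUnitalNonAssocRing B] [Module K B]

/-- Assignments of elements of `A` to variables `x i`, `y i` and `z`. -/
abbrev Assignment (n : ℕ) (A : Type*) := (Fin n → A) × (Fin n → A) × A

/-- `F` consists of pairs of functions on `A` and `B` defined by the same nonassociative
polynomials with operators, and `A` and `B` have the same identities. -/
structure IsPolynomialPairs (opA : S → End K A) (opB : S → End K B)
    (F : Submodule K ((Assignment n A → A) × (Assignment n B → B))) : Prop where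
  x_mem : ∀ i, (fun e ↦ e.1 i, fun e ↦ e.1 i) ∈ F
  y_mem : ∀ i, (fun e ↦ e.2.1 i, fun e ↦ e.2.1 i) ∈ F
  z_mem : (fun e ↦ e.2.2, fun e ↦ e.2.2) ∈ F
  mul_mem : ∀ p ∈ F, ∀ q ∈ F, p * q ∈ F
  op_mem : ∀ s, ∀ p ∈ F, (fun e ↦ opA s (p.1 e), fun e ↦ opB s (p.2 e)) ∈ F
  eq_zero_iff : ∀ p ∈ F, p.1 = 0 ↔ p.2 = 0

/-- Pairs of operator-valued functions preserving `F`. -/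
def operatorPairs (F : Submodule K ((Assignment n A → A) × (Assignment n B → B))) :
    Subalgebra K ((Assignment n A → End K A) × (Assignment n B → End K B)) where
  carrier := {U | ∀ p ∈ F, (fun e ↦ U.1 e (p.1 e), fun e ↦ U.2 e (p.2 e)) ∈ F}
  mul_mem' hU hV p hp := hU _ (hV p hp)
  add_mem' hU hV p hp := F.add_mem (hU p hp) (hV p hp)
  algebraMap_mem' c _ hp := F.smul_mem c hp

variable {opA : S → End K A} {opB : S → End K B}
  {F : Submodule K ((Assignment n A → A) × (Assignment n B → B))}

theorem IsPolynomialPairs.mulLeft_mem [SMulCommClass K A A] [SMulCommClass K B B]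
    (hF : IsPolynomialPairs opA opB F) {p} (hp : p ∈ F) :
    (fun e ↦ LinearMap.mulLeft K (p.1 e), fun e ↦ LinearMap.mulLeft K (p.2 e)) ∈
      operatorPairs F :=
  fun q hq ↦ hF.mul_mem p hp q hq

theorem IsPolynomialPairs.mulRight_mem [IsScalarTower K A A] [IsScalarTower K B B]
    (hF : IsPolynomialPairs opA opB F) {p} (hp : p ∈ F) :
    (fun e ↦ LinearMap.mulRight K (p.1 e), fun e ↦ LinearMap.mulRight K (p.2 e)) ∈
      operatorPairs F :=
  fun q hq ↦ hF.mul_mem q hq p hp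

variable [SMulCommClass K A A] [IsScalarTower K A A] [SMulCommClass K B B] [IsScalarTower K B B]

/-- Operators in the multiplication algebra are values of operator polynomials in `y`. -/
theorem IsPolynomialPairs.exists_operator (hF : IsPolynomialPairs opA opB F)
    (a : Basis (Fin n) K A) {T : End K A} (hT : T ∈ multiplicationAlgebra opA) :
    ∃ (U : (Fin n → A) → End K A) (V : (Fin n → B) → End K B),
      (fun e ↦ U e.2.1, fun e ↦ V e.2.1) ∈ operatorPairs F ∧ U a = T := by
  have hlin (c : A) : ((fun e ↦ ∑ i, a.repr c i • e.2.1 i, fun e ↦ ∑ i, a.repr c i • e.2.1 i) :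
      (Assignment n A → A) × (Assignment n B → B)) ∈ F := by
    have := F.sum_mem (t := Finset.univ) fun i _ ↦ F.smul_mem (a.repr c i) (hF.y_mem i)
    convert this using 1
    ext e <;> simp [Prod.fst_sum, Prod.snd_sum]
  induction hT using Algebra.adjoin_induction with
  | mem T hT =>
    rcases hT with (⟨c, rfl⟩ | ⟨c, rfl⟩) | ⟨s, rfl⟩
    · exact ⟨fun y ↦ .mulLeft K (∑ i, a.repr c i • y i), fun y ↦ .mulLeft K (∑ i, a.repr c i • y i),
        hF.mulLeft_mem (hlin c), by simp only [a.sum_repr]⟩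
    · exact ⟨fun y ↦ .mulRight K (∑ i, a.repr c i • y i),
        fun y ↦ .mulRight K (∑ i, a.repr c i • y i),
        hF.mulRight_mem (hlin c), by simp only [a.sum_repr]⟩
    · exact ⟨fun _ ↦ opA s, fun _ ↦ opB s, hF.op_mem s, rfl⟩
  | algebraMap c =>
    exact ⟨fun _ ↦ algebraMap _ _ c, fun _ ↦ algebraMap _ _ c, algebraMap_mem (operatorPairs F) c,
      rfl⟩
  | add T T' _ _ h h' =>
    obtain ⟨U, V, hUV, rfl⟩ := h
    obtain ⟨U', V', hUV', rfl⟩ := h'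
    exact ⟨U + U', V + V', add_mem hUV hUV', rfl⟩
  | mul T T' _ _ h h' =>
    obtain ⟨U, V, hUV, rfl⟩ := h
    obtain ⟨U', V', hUV', rfl⟩ := h'
    exact ⟨U * U', V * V', (operatorPairs F).mul_mem hUV hUV', rfl⟩

/-- The pair of operator-valued functions obtained by substituting `w` into alternating maps
depending on `y`. -/
def alternatingPair (CA : (Fin n → A) → A [⋀^Fin n]→ₗ[K] End K A)
    (CB : (Fin n → B) → B [⋀^Fin n]→ₗ[K] End K B)
    (w : Fin n → (Assignment n A → A) × (Assignment n B → B)) :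
    (Assignment n A → End K A) × (Assignment n B → End K B) :=
  (fun e ↦ CA e.2.1 fun j ↦ (w j).1 e, fun e ↦ CB e.2.1 fun j ↦ (w j).2 e)

theorem IsPolynomialPairs.exists_alternating (hF : IsPolynomialPairs opA opB F)
    (a : Basis (Fin n) K A) (hA : multiplicationAlgebra opA = ⊤) (hmul : ∃ u v : A, u * v ≠ 0) :
    ∃ (CA : (Fin n → A) → A [⋀^Fin n]→ₗ[K] End K A) (CB : (Fin n → B) → B [⋀^Fin n]→ₗ[K] End K B),
      (∀ w, (∀ j, w j ∈ F) → alternatingPair CA CB w ∈ operatorPairs F) ∧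
      ∃ v ≠ 0, CA a a v = v := by
  obtain ⟨u, v, huv⟩ := hmul
  have hlift (T : End K A) := hF.exists_operator a (T := T) (hA ▸ Algebra.mem_top)
  obtain ⟨f, hf⟩ : ∃ f : A →ₗ[K] K, f (u * v) = 1 := by
    obtain ⟨i, hi⟩ : ∃ i, a.coord i (u * v) ≠ 0 := by
      contrapose! huv
      exact a.forall_coord_eq_zero_iff.1 huv
    exact ⟨(a.coord i (u * v))⁻¹ • a.coord i, inv_mul_cancel₀ hi⟩
  obtain ⟨UA, UB, hU, hUa⟩ := hlift (f.smulRight v)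
  choose TA TB hT hTa using fun i ↦ hlift ((a.coord i).smulRight u)
  refine ⟨fun y ↦ capelliMap fun i ↦ LinearMap.mulLeft K (UA y) ∘ₗ LinearMap.mul K A ∘ₗ TA i y,
    fun y ↦ capelliMap fun i ↦ LinearMap.mulLeft K (UB y) ∘ₗ LinearMap.mul K B ∘ₗ TB i y,
    fun w hw ↦ ?_, v, ?_, ?_⟩
  · have := capelli_mem (operatorPairs F) fun i j ↦
      (operatorPairs F).mul_mem hU (hF.mulLeft_mem (hT i (w j) (hw j)))
    rw [capelli_eq_pair] at this
    simp only [alternatingPair, capelliMap_apply]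
    exact this
  · rintro rfl
    simp at huv
  · rw [capelliMap_apply]
    refine capelli_apply_of_diagonal _ v fun i j ↦ ?_
    change UA a (TA i a (a j) * v) = _
    rw [hUa, hTa, LinearMap.smulRight_apply, LinearMap.smulRight_apply, Basis.coord_apply,
      Basis.repr_self, Finsupp.single_apply, smul_mul_assoc, map_smul, hf, smul_eq_mul, mul_one,
      ite_smul, one_smul, zero_smul]
    simp only [eq_comm]

end PolynomialPairs

section Transfer

variable {K A B S : Type*} {n : ℕ} [Field K]
  [NonUnitalNonAssocRing A] [Module K A] [NonUnitalNonAssocRing B] [Module K B]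

theorem alternatingMap_eq_det_smul {ι M V : Type*} [Fintype ι] [DecidableEq ι] [AddCommGroup V]
    [Module K V] [AddCommGroup M] [Module K M] (b : Basis ι K V) (f : V [⋀^ι]→ₗ[K] M)
    (v : ι → V) : f v = b.det v • f b := by
  have : f = (LinearMap.toSpanSingleton K M (f b)).compAlternatingMap b.det := by
    refine b.ext_alternating fun w hw ↦ ?_
    let σ := Equiv.ofBijective w (Finite.injective_iff_bijective.1 hw)
    change f (b ∘ σ) = b.det (b ∘ σ) • f b
    simp [AlternatingMap.map_perm, b.det_self]
  exact DFunLike.congr_fun this v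

/-- The entry whose coordinate `constantIndex q` is the structure constant indexed by `q`. -/
def constantEntry (op : S → End K A) (x : Fin n → A) :
    (Fin n × Fin n × Fin n) ⊕ (S × Fin n × Fin n) → A :=
  Sum.elim (fun t ↦ x t.1 * x t.2.1) fun t ↦ op t.1 (x t.2.1)

/-- The coordinate defining the structure constant indexed by `q`. -/
def constantIndex : (Fin n × Fin n × Fin n) ⊕ (S × Fin n × Fin n) → Fin n :=
  Sum.elim (fun t ↦ t.2.2) fun t ↦ t.2.2

theorem structureConstants_eq_repr (op : S → End K A) (b : Basis (Fin n) K A)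
    (q : (Fin n × Fin n × Fin n) ⊕ (S × Fin n × Fin n)) :
    structureConstants op b q = b.repr (constantEntry op b q) (constantIndex q) := by
  cases q <;> rfl

/-- `U` represents the polynomial `p` in the structure constants, up to the `N`-th power of the
alternating operator `C`. -/
def Represents (op : S → End K A) (C : (Fin n → A) → A [⋀^Fin n]→ₗ[K] End K A)
    (p : MvPolynomial ((Fin n × Fin n × Fin n) ⊕ (S × Fin n × Fin n)) K) (N : ℕ)
    (U : Assignment n A → End K A) : Prop :=
  (∀ (b : Basis (Fin n) K A) y z,
    U (b, y, z) = MvPolynomial.aeval (structureConstants op b) p • C y b ^ N) ∧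
  ∀ e, ¬ LinearIndependent K e.1 → U e = 0

variable {op : S → End K A} {C : (Fin n → A) → A [⋀^Fin n]→ₗ[K] End K A}
  {p p' : MvPolynomial ((Fin n × Fin n × Fin n) ⊕ (S × Fin n × Fin n)) K} {N N' : ℕ}
  {U U' : Assignment n A → End K A}

theorem represents_C (c : K) :
    Represents op C (MvPolynomial.C c) 1 (c • fun e ↦ C e.2.1 e.1) := by
  refine ⟨fun b y z ↦ ?_, fun e he ↦ ?_⟩
  · simp
  · simp [(C e.2.1).map_linearDependent e.1 he]

theorem Represents.add (h : Represents op C p N U) (h' : Represents op C p' N' U') :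
    Represents op C (p + p') (N + N')
      (U * (fun e ↦ C e.2.1 e.1) ^ N' + U' * (fun e ↦ C e.2.1 e.1) ^ N) := by
  refine ⟨fun b y z ↦ ?_, fun e he ↦ ?_⟩
  · simp [h.1, h'.1, add_smul, pow_add, pow_mul_comm (C y b) N]
  · simp [h.2 e he, h'.2 e he]

theorem Represents.mul_X (h : Represents op C p N U)
    (q : (Fin n × Fin n × Fin n) ⊕ (S × Fin n × Fin n)) :
    Represents op C (p * MvPolynomial.X q) (N + 1) (U * fun e ↦
      C e.2.1 (Function.update e.1 (constantIndex q) (constantEntry op e.1 q))) := by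
  refine ⟨fun b y z ↦ ?_, fun e he ↦ ?_⟩
  · have hq : C y (Function.update b (constantIndex q) (constantEntry op b q)) =
        structureConstants op b q • C y b := by
      rw [structureConstants_eq_repr, alternatingMap_eq_det_smul b, b.det_apply,
        b.toMatrix_update, Basis.toMatrix_self, ← Matrix.cramer_apply, Matrix.cramer_one,
        Module.End.one_apply]
    simp [h.1, hq, pow_succ, smul_smul, mul_comm]
  · simp [h.2 e he]

theorem Represents.forall_aeval_eq_zero_iff (hn : finrank K A = n) [FiniteDimensional K A]
    (h : Represents op C p N U)
    (hC : ∃ e : Assignment n A, (C e.2.1 e.1 ^ N) e.2.2 ≠ 0) :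
    (∀ b : Basis (Fin n) K A, MvPolynomial.aeval (structureConstants op b) p = 0) ↔
      (fun e ↦ U e e.2.2) = 0 := by
  constructor
  · intro hp
    funext ⟨x, y, z⟩
    by_cases hx : LinearIndependent K x
    · have := h.1 (Basis.mk hx
        (hx.span_eq_top_of_card_eq_finrank' (by simp [hn])).ge) y z
      rw [hp, zero_smul, Basis.coe_mk] at this
      simp [this]
    · simp [h.2 (x, y, z) hx]
  · intro hU b
    obtain ⟨⟨x, y, z⟩, hC⟩ := hC
    have hUb := congrFun hU (b, y, z)
    simp only [h.1, LinearMap.smul_apply, Pi.zero_apply, smul_eq_zero] at hUb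
    refine hUb.resolve_right fun h0 ↦ hC ?_
    simp only
    rw [alternatingMap_eq_det_smul b, smul_pow, LinearMap.smul_apply, h0, smul_zero]

variable {opA : S → End K A} {opB : S → End K B}
  {F : Submodule K ((Assignment n A → A) × (Assignment n B → B))}
  {CA : (Fin n → A) → A [⋀^Fin n]→ₗ[K] End K A} {CB : (Fin n → B) → B [⋀^Fin n]→ₗ[K] End K B}

theorem IsPolynomialPairs.exists_represents (hF : IsPolynomialPairs opA opB F)
    (hC : ∀ w, (∀ j, w j ∈ F) → alternatingPair CA CB w ∈ operatorPairs F)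
    (p : MvPolynomial ((Fin n × Fin n × Fin n) ⊕ (S × Fin n × Fin n)) K) :
    ∃ N, ∃ U ∈ operatorPairs F, Represents opA CA p N U.1 ∧ Represents opB CB p N U.2 := by
  have hD := hC (fun j ↦ (fun e ↦ e.1 j, fun e ↦ e.1 j)) hF.x_mem
  induction p using MvPolynomial.induction_on with
  | C c => exact ⟨1, _, (operatorPairs F).smul_mem hD c, represents_C c, represents_C c⟩
  | add p p' h h' =>
    obtain ⟨N, U, hU, hUA, hUB⟩ := h
    obtain ⟨N', U', hU', hUA', hUB'⟩ := h'
    exact ⟨N + N', _, (operatorPairs F).add_mem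
      ((operatorPairs F).mul_mem hU ((operatorPairs F).pow_mem hD N'))
      ((operatorPairs F).mul_mem hU' ((operatorPairs F).pow_mem hD N)),
      hUA.add hUA', hUB.add hUB'⟩
  | mul_X p q h =>
    obtain ⟨N, U, hU, hUA, hUB⟩ := h
    refine ⟨N + 1, U * (fun e ↦ CA e.2.1
        (Function.update e.1 (constantIndex q) (constantEntry opA e.1 q)), fun e ↦ CB e.2.1
        (Function.update e.1 (constantIndex q) (constantEntry opB e.1 q))),
      (operatorPairs F).mul_mem hU ?_, hUA.mul_X q, hUB.mul_X q⟩
    have hq : ((fun e ↦ constantEntry opA e.1 q, fun e ↦ constantEntry opB e.1 q) :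
        (Assignment n A → A) × (Assignment n B → B)) ∈ F := by
      rcases q with ⟨i, j, k⟩ | ⟨s, i, k⟩
      · exact hF.mul_mem _ (hF.x_mem i) _ (hF.x_mem j)
      · exact hF.op_mem s _ (hF.x_mem i)
    have := hC (Function.update (fun j ↦ (fun e ↦ e.1 j, fun e ↦ e.1 j)) (constantIndex q) _)
      fun j ↦ by
        rcases eq_or_ne j (constantIndex q) with rfl | hj
        · rw [Function.update_self]
          exact hq
        · rw [Function.update_of_ne hj]
          exact hF.x_mem j
    convert this using 1
    refine Prod.ext (funext fun e ↦ congrArg _ (funext fun j ↦ ?_))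
      (funext fun e ↦ congrArg _ (funext fun j ↦ ?_)) <;>
    · rcases eq_or_ne j (constantIndex q) with rfl | hj
      · simp only [Function.update_self]
      · simp only [Function.update_of_ne hj]

theorem exists_equiv_of_isPolynomialPairs {K A B : Type*} {S : Type} [Field K] [IsAlgClosed K]
    [NonUnitalNonAssocRing A] [Module K A] [SMulCommClass K A A] [IsScalarTower K A A]
    [FiniteDimensional K A]
    [NonUnitalNonAssocRing B] [Module K B] [SMulCommClass K B B] [IsScalarTower K B B]
    [FiniteDimensional K B] {opA : S → End K A} {opB : S → End K B}
    {F : Submodule K ((Assignment (finrank K A) A → A) × (Assignment (finrank K A) B → B))}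
    (hF : IsPolynomialPairs opA opB F) (hA : multiplicationAlgebra opA = ⊤)
    (hmul : ∃ u v : A, u * v ≠ 0) (hle : finrank K B ≤ finrank K A) :
    ∃ φ : A ≃ₗ[K] B, (∀ a b, φ (a * b) = φ a * φ b) ∧ ∀ s a, φ (opA s a) = opB s (φ a) := by
  let a := Module.finBasis K A
  obtain ⟨CA, CB, hC, v, hv, hav⟩ := hF.exists_alternating a hA hmul
  have hCA (N : ℕ) : ∃ e : Assignment (finrank K A) A, (CA e.2.1 e.1 ^ N) e.2.2 ≠ 0 := by
    refine ⟨(a, a, v), ?_⟩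
    have : (CA a a ^ N) v = v := by
      induction N with
      | zero => rfl
      | succ N ih => rw [pow_succ, Module.End.mul_apply, hav, ih]
    exact this.trans_ne hv
  have hCB (N : ℕ) : ∃ e : Assignment (finrank K A) B, (CB e.2.1 e.1 ^ N) e.2.2 ≠ 0 := by
    have hD := (operatorPairs F).pow_mem
      (hC (fun j ↦ (fun e ↦ e.1 j, fun e ↦ e.1 j)) hF.x_mem) N _ hF.z_mem
    by_contra! h
    obtain ⟨e, he⟩ := hCA N
    exact he (congrFun ((hF.eq_zero_iff _ hD).2 (funext h)) e)
  have hn : finrank K B = finrank K A := by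
    refine hle.antisymm ?_
    obtain ⟨e, he⟩ := hCB 1
    have : LinearIndependent K e.1 := by
      contrapose! he
      rw [(CB e.2.1).map_linearDependent e.1 he]
      simp
    simpa using this.fintype_card_le_finrank
  obtain ⟨b, b', h⟩ := exists_bases_of_same_equations opA opB a
    ((Module.finBasis K B).reindex (finCongr hn)) fun p ↦ by
      obtain ⟨N, U, hU, hUA, hUB⟩ := hF.exists_represents hC p
      rw [hUA.forall_aeval_eq_zero_iff rfl (hCA N), hUB.forall_aeval_eq_zero_iff hn (hCB N)]
      exact hF.eq_zero_iff _ (hU _ hF.z_mem)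
  exact exists_equiv_of_structureConstants_eq opA opB b b' h

end Transfer

section Homogeneous

variable {K A : Type*} [Field K] [NonUnitalNonAssocRing A] [Module K A]
  (𝒜 : ZMod 2 → Submodule K A) [DirectSum.Decomposition 𝒜] (st : A →ₗ[K] A)

/-- The projection onto the homogeneous component of degree `g`. -/
def homogeneousProj (g : ZMod 2) : End K A :=
  (𝒜 g).subtype ∘ₗ DirectSum.component K _ _ g ∘ₗ (DirectSum.decomposeLinearEquiv 𝒜).toLinearMap

theorem homogeneousProj_mem (g : ZMod 2) (a : A) : homogeneousProj 𝒜 g a ∈ 𝒜 g :=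
  (DirectSum.decompose 𝒜 a g).2

variable {𝒜} in
theorem homogeneousProj_of_mem {g : ZMod 2} {a : A} (ha : a ∈ 𝒜 g) (h : ZMod 2) :
    homogeneousProj 𝒜 h a = if g = h then a else 0 := by
  split_ifs with hgh
  · subst hgh
    exact DirectSum.decompose_of_mem_same 𝒜 ha
  · exact DirectSum.decompose_of_mem_ne 𝒜 ha hgh

theorem sum_homogeneousProj (a : A) : ∑ g, homogeneousProj 𝒜 g a = a := by
  classical
  refine Eq.trans ?_ (DirectSum.sum_support_decompose 𝒜 a)
  refine (Finset.sum_subset (Finset.subset_univ _) fun g _ hg ↦ ?_).symm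
  change ((DirectSum.decompose 𝒜 a g : 𝒜 g) : A) = 0
  rw [DFinsupp.notMem_support_iff.1 hg, ZeroMemClass.coe_zero]

variable {𝒜} in
theorem homogeneousProj_mul (hgr : ∀ g h, ∀ a ∈ 𝒜 g, ∀ b ∈ 𝒜 h, a * b ∈ 𝒜 (g + h))
    (h : ZMod 2) (a b : A) : homogeneousProj 𝒜 h (a * b) =
      ∑ g, homogeneousProj 𝒜 g a * homogeneousProj 𝒜 (h - g) b := by
  conv_lhs => rw [← sum_homogeneousProj 𝒜 a, ← sum_homogeneousProj 𝒜 b, Finset.sum_mul_sum]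
  rw [map_sum]
  refine Finset.sum_congr rfl fun g _ ↦ ?_
  rw [map_sum, Finset.sum_eq_single (h - g)]
  · rw [homogeneousProj_of_mem (hgr _ _ _ (homogeneousProj_mem ..) _ (homogeneousProj_mem ..)),
      if_pos (add_sub_cancel ..)]
  · intro k _ hk
    rw [homogeneousProj_of_mem (hgr _ _ _ (homogeneousProj_mem ..) _ (homogeneousProj_mem ..)),
      if_neg fun h' ↦ hk (eq_sub_of_add_eq' h')]
  · simp

/-- The operators of a superalgebra with involution: the involution and the projections onto the
homogeneous components. -/
def superStarOp : Option (ZMod 2) → End K A :=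
  fun s ↦ s.elim st (homogeneousProj 𝒜)

variable {𝒜 st}

/-- Irreducibility of the action of multiplications and operators. -/
theorem IsSuperStarSimple.eq_bot_or_eq_top (hA : IsSuperStarSimple 𝒜 st) (I : Submodule K A)
    (hmul : ∀ a ∈ I, ∀ b, a * b ∈ I ∧ b * a ∈ I)
    (hop : ∀ s, ∀ a ∈ I, superStarOp 𝒜 st s a ∈ I) : I = ⊥ ∨ I = ⊤ := by
  refine hA.2 I ⟨hmul, le_antisymm (fun a ha ↦ ?_) (iSup_le fun g ↦ inf_le_left), hop none⟩
  rw [← sum_homogeneousProj 𝒜 a]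
  exact Submodule.sum_mem _ fun g _ ↦
    Submodule.mem_iSup_of_mem g ⟨hop (some g) a ha, homogeneousProj_mem 𝒜 g a⟩

theorem map_eq_of_map_superStarOp {B : Type*} [NonUnitalNonAssocRing B] [Module K B]
    {ℬ : ZMod 2 → Submodule K B} [DirectSum.Decomposition ℬ] {stB : B →ₗ[K] B} (φ : A ≃ₗ[K] B)
    (h : ∀ s a, φ (superStarOp 𝒜 st s a) = superStarOp ℬ stB s (φ a)) (g : ZMod 2) :
    Submodule.map (φ : A →ₗ[K] B) (𝒜 g) = ℬ g := by
  have hg (a : A) : φ (homogeneousProj 𝒜 g a) = homogeneousProj ℬ g (φ a) := h (some g) a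
  refine le_antisymm (Submodule.map_le_iff_le_comap.2 fun a ha ↦ ?_) fun b hb ↦ ?_
  · have := hg a
    rw [homogeneousProj_of_mem ha, if_pos rfl] at this
    rw [Submodule.mem_comap, LinearEquiv.coe_coe, this]
    exact homogeneousProj_mem ℬ g (φ a)
  · refine ⟨homogeneousProj 𝒜 g (φ.symm b), homogeneousProj_mem .., ?_⟩
    refine (hg _).trans ?_
    rw [φ.apply_symm_apply, homogeneousProj_of_mem hb, if_pos rfl]

end Homogeneous

section Evaluation

theorem FreeNonUnitalNonAssocAlgebra.induction {R X : Type*} [CommSemiring R]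
    {P : FreeNonUnitalNonAssocAlgebra R X → Prop} (zero : P 0)
    (of : ∀ x, P (FreeNonUnitalNonAssocAlgebra.of R x))
    (add : ∀ f g, P f → P g → P (f + g)) (smul : ∀ (r : R) f, P f → P (r • f))
    (mul : ∀ f g, P f → P g → P (f * g)) (f : FreeNonUnitalNonAssocAlgebra R X) : P f := by
  have hm (m : FreeMagma X) : P (MonoidAlgebra.single m 1) := by
    induction m using FreeMagma.recOnMul with
    | ih1 x => exact of x
    | ih2 m m' h h' => simpa [MonoidAlgebra.single_mul_single] using mul _ _ h h'
  induction f using MonoidAlgebra.induction_linear with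
  | zero => exact zero
  | add f g hf hg => exact add f g hf hg
  | single m r => simpa using smul r _ (hm m)

variable {K A B : Type*} [Field K]
  [NonUnitalNonAssocRing A] [Module K A] [SMulCommClass K A A] [IsScalarTower K A A]
  [NonUnitalNonAssocRing B] [Module K B] [SMulCommClass K B B] [IsScalarTower K B B]

/-- Evaluation of polynomials at an assignment of elements to the variables `x^{(g)}`. -/
noncomputable def superStarEval (st : A →ₗ[K] A) (e : ℕ × ZMod 2 → A) :
    FreeNonUnitalNonAssocAlgebra K (ℕ × ZMod 2 × Bool) →ₙₐ[K] A :=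
  FreeNonUnitalNonAssocAlgebra.lift K fun p ↦
    if p.2.2 then st (e (p.1, p.2.1)) else e (p.1, p.2.1)

/-- `f' s` evaluates to the image of the value of `f` under the operator indexed by `s`. -/
def IsOperatorImage (𝒜 : ZMod 2 → Submodule K A) [DirectSum.Decomposition 𝒜] (st : A →ₗ[K] A)
    (f : FreeNonUnitalNonAssocAlgebra K (ℕ × ZMod 2 × Bool))
    (f' : Option (ZMod 2) → FreeNonUnitalNonAssocAlgebra K (ℕ × ZMod 2 × Bool)) : Prop :=
  ∀ e : ℕ × ZMod 2 → A, (∀ x g, e (x, g) ∈ 𝒜 g) →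
    ∀ s, superStarEval st e (f' s) = superStarOp 𝒜 st s (superStarEval st e f)

/-- The assignment given by a sequence of elements. -/
def sequenceAssignment (n : ℕ) {A : Type*} (t : ℕ → A) : Assignment n A :=
  let v : Fin n ⊕ Fin n ⊕ Unit → A := t ∘ Encodable.encode
  (v ∘ .inl, v ∘ .inr ∘ .inl, v (.inr (.inr ())))

theorem sequenceAssignment_surjective (n : ℕ) {A : Type*} [Inhabited A] :
    Function.Surjective (sequenceAssignment n (A := A)) := by
  rintro ⟨x, y, z⟩
  refine ⟨Function.extend (Encodable.encode (α := Fin n ⊕ Fin n ⊕ Unit))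
    (Sum.elim x (Sum.elim y fun _ ↦ z)) fun _ ↦ default, ?_⟩
  simp only [sequenceAssignment, Function.extend_comp Encodable.encode_injective]
  rfl

/-- `f` evaluates to `P` when the variable `x` of degree `0` plus that of degree `1` is viewed as
an arbitrary element. -/
def EvaluatesTo (n : ℕ) (𝒜 : ZMod 2 → Submodule K A) (st : A →ₗ[K] A)
    (f : FreeNonUnitalNonAssocAlgebra K (ℕ × ZMod 2 × Bool)) (P : Assignment n A → A) : Prop :=
  ∀ e : ℕ × ZMod 2 → A, (∀ x g, e (x, g) ∈ 𝒜 g) →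
    superStarEval st e f = P (sequenceAssignment n fun x ↦ ∑ g, e (x, g))

theorem evaluatesTo_sequence (n : ℕ) {𝒜 : ZMod 2 → Submodule K A} {st : A →ₗ[K] A} (x : ℕ)
    (P : Assignment n A → A)
    (hP : ∀ t, P (sequenceAssignment n t) = t x) :
    EvaluatesTo n 𝒜 st (∑ g, .of K (x, g, false)) P := by
  intro e _
  simp [hP, superStarEval]

section

variable {𝒜 : ZMod 2 → Submodule K A} [DirectSum.Decomposition 𝒜] {st : A →ₗ[K] A}

theorem isOperatorImage_of (hst : ∀ a, st (st a) = a) (hst' : ∀ g, ∀ a ∈ 𝒜 g, st a ∈ 𝒜 g)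
    (p : ℕ × ZMod 2 × Bool) :
    IsOperatorImage 𝒜 st (.of K p) fun s ↦ s.elim (.of K (p.1, p.2.1, !p.2.2)) fun h ↦
      if p.2.1 = h then .of K p else 0 := by
  obtain ⟨x, g, b⟩ := p
  rintro e he (_ | h)
  · cases b <;> simp [superStarEval, superStarOp, hst]
  · have : superStarEval st e (.of K (x, g, b)) ∈ 𝒜 g := by
      cases b <;> simp [superStarEval, he, hst']
    simp only [superStarOp, Option.elim_some, homogeneousProj_of_mem this]
    split_ifs <;> simp

theorem IsOperatorImage.mul (hst : ∀ a b, st (a * b) = st b * st a)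
    (hgr : ∀ g h, ∀ a ∈ 𝒜 g, ∀ b ∈ 𝒜 h, a * b ∈ 𝒜 (g + h))
    {f₁ f₂ : FreeNonUnitalNonAssocAlgebra K (ℕ × ZMod 2 × Bool)}
    {f₁' f₂' : Option (ZMod 2) → FreeNonUnitalNonAssocAlgebra K (ℕ × ZMod 2 × Bool)}
    (h₁ : IsOperatorImage 𝒜 st f₁ f₁') (h₂ : IsOperatorImage 𝒜 st f₂ f₂') :
    IsOperatorImage 𝒜 st (f₁ * f₂) fun s ↦ s.elim (f₂' none * f₁' none) fun h ↦
      ∑ g, f₁' (some g) * f₂' (some (h - g)) := by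
  rintro e he (_ | h)
  · simp [h₁ e he, h₂ e he, superStarOp, hst]
  · simp [h₁ e he, h₂ e he, superStarOp, homogeneousProj_mul hgr]

end

variable {𝒜 : ZMod 2 → Submodule K A} [DirectSum.Decomposition 𝒜] {stA : A →ₗ[K] A}
  {ℬ : ZMod 2 → Submodule K B} [DirectSum.Decomposition ℬ] {stB : B →ₗ[K] B}

theorem exists_isOperatorImage
    (hgrA : ∀ g h, ∀ a ∈ 𝒜 g, ∀ b ∈ 𝒜 h, a * b ∈ 𝒜 (g + h))
    (hgrB : ∀ g h, ∀ a ∈ ℬ g, ∀ b ∈ ℬ h, a * b ∈ ℬ (g + h))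
    (hA1 : ∀ a, stA (stA a) = a) (hA2 : ∀ a b, stA (a * b) = stA b * stA a)
    (hA3 : ∀ g, ∀ a ∈ 𝒜 g, stA a ∈ 𝒜 g)
    (hB1 : ∀ a, stB (stB a) = a) (hB2 : ∀ a b, stB (a * b) = stB b * stB a)
    (hB3 : ∀ g, ∀ a ∈ ℬ g, stB a ∈ ℬ g)
    (f : FreeNonUnitalNonAssocAlgebra K (ℕ × ZMod 2 × Bool)) :
    ∃ f', IsOperatorImage 𝒜 stA f f' ∧ IsOperatorImage ℬ stB f f' := by
  induction f using FreeNonUnitalNonAssocAlgebra.induction with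
  | zero => exact ⟨0, fun e he s ↦ by simp, fun e he s ↦ by simp⟩
  | of p => exact ⟨_, isOperatorImage_of hA1 hA3 p, isOperatorImage_of hB1 hB3 p⟩
  | add f₁ f₂ h₁ h₂ =>
    obtain ⟨f₁', h₁A, h₁B⟩ := h₁
    obtain ⟨f₂', h₂A, h₂B⟩ := h₂
    exact ⟨f₁' + f₂', fun e he s ↦ by simp [h₁A e he, h₂A e he],
      fun e he s ↦ by simp [h₁B e he, h₂B e he]⟩
  | smul r f h =>
    obtain ⟨f', hA, hB⟩ := h
    exact ⟨r • f', fun e he s ↦ by simp [hA e he], fun e he s ↦ by simp [hB e he]⟩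
  | mul f₁ f₂ h₁ h₂ =>
    obtain ⟨f₁', h₁A, h₁B⟩ := h₁
    obtain ⟨f₂', h₂A, h₂B⟩ := h₂
    exact ⟨_, h₁A.mul hA2 hgrA h₂A, h₁B.mul hB2 hgrB h₂B⟩

theorem EvaluatesTo.eq_zero_iff {n : ℕ} {f : FreeNonUnitalNonAssocAlgebra K (ℕ × ZMod 2 × Bool)}
    {P : Assignment n A → A} (h : EvaluatesTo n 𝒜 stA f P) :
    P = 0 ↔ IsSuperStarPI 𝒜 stA f := by
  refine ⟨fun hP e he ↦ ?_, fun hf ↦ funext fun a ↦ ?_⟩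
  · subst hP
    exact h e he
  · have : Inhabited A := ⟨0⟩
    obtain ⟨t, rfl⟩ := sequenceAssignment_surjective n a
    let e (q : ℕ × ZMod 2) : A := homogeneousProj 𝒜 q.2 (t q.1)
    have he (x : ℕ) (g : ZMod 2) : e (x, g) ∈ 𝒜 g := homogeneousProj_mem 𝒜 g (t x)
    have h0 : superStarEval stA e f = 0 := hf e he
    rw [h e he] at h0
    simp only [e, sum_homogeneousProj] at h0
    exact h0

/-- The pairs of functions obtained by evaluating a polynomial on `A` and on `B`. -/
def evaluationPairs (n : ℕ) (𝒜 : ZMod 2 → Submodule K A) (stA : A →ₗ[K] A)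
    (ℬ : ZMod 2 → Submodule K B) (stB : B →ₗ[K] B) :
    Submodule K ((Assignment n A → A) × (Assignment n B → B)) where
  carrier := {P | ∃ f, EvaluatesTo n 𝒜 stA f P.1 ∧ EvaluatesTo n ℬ stB f P.2}
  zero_mem' := ⟨0, fun _ _ ↦ map_zero _, fun _ _ ↦ map_zero _⟩
  add_mem' := by
    rintro P Q ⟨f, hA, hB⟩ ⟨f', hA', hB'⟩
    exact ⟨f + f', fun e he ↦ by simp [hA e he, hA' e he], fun e he ↦ by simp [hB e he, hB' e he]⟩
  smul_mem' := by
    rintro c P ⟨f, hA, hB⟩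
    exact ⟨c • f, fun e he ↦ by simp [hA e he], fun e he ↦ by simp [hB e he]⟩

theorem isPolynomialPairs_evaluationPairs (n : ℕ)
    (hgrA : ∀ g h, ∀ a ∈ 𝒜 g, ∀ b ∈ 𝒜 h, a * b ∈ 𝒜 (g + h))
    (hgrB : ∀ g h, ∀ a ∈ ℬ g, ∀ b ∈ ℬ h, a * b ∈ ℬ (g + h))
    (hA1 : ∀ a, stA (stA a) = a) (hA2 : ∀ a b, stA (a * b) = stA b * stA a)
    (hA3 : ∀ g, ∀ a ∈ 𝒜 g, stA a ∈ 𝒜 g)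
    (hB1 : ∀ a, stB (stB a) = a) (hB2 : ∀ a b, stB (a * b) = stB b * stB a)
    (hB3 : ∀ g, ∀ a ∈ ℬ g, stB a ∈ ℬ g)
    (hsame : ∀ f, IsSuperStarPI 𝒜 stA f ↔ IsSuperStarPI ℬ stB f) :
    IsPolynomialPairs (superStarOp 𝒜 stA) (superStarOp ℬ stB)
      (evaluationPairs n 𝒜 stA ℬ stB) where
  x_mem i := ⟨_, evaluatesTo_sequence n _ _ fun _ ↦ rfl, evaluatesTo_sequence n _ _ fun _ ↦ rfl⟩
  y_mem i := ⟨_, evaluatesTo_sequence n _ _ fun _ ↦ rfl, evaluatesTo_sequence n _ _ fun _ ↦ rfl⟩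
  z_mem := ⟨_, evaluatesTo_sequence n _ _ fun _ ↦ rfl, evaluatesTo_sequence n _ _ fun _ ↦ rfl⟩
  mul_mem := by
    rintro P ⟨f, hA, hB⟩ Q ⟨f', hA', hB'⟩
    exact ⟨f * f', fun e he ↦ by simp [hA e he, hA' e he], fun e he ↦ by simp [hB e he, hB' e he]⟩
  op_mem := by
    rintro s P ⟨f, hA, hB⟩
    obtain ⟨f', hA', hB'⟩ := exists_isOperatorImage hgrA hgrB hA1 hA2 hA3 hB1 hB2 hB3 f
    exact ⟨f' s, fun e he ↦ by rw [hA' e he, hA e he], fun e he ↦ by rw [hB' e he, hB e he]⟩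
  eq_zero_iff := by
    rintro P ⟨f, hA, hB⟩
    rw [hA.eq_zero_iff, hB.eq_zero_iff, hsame]

theorem exists_superStarEquiv_of_finrank_le [IsAlgClosed K] [FiniteDimensional K A]
    [FiniteDimensional K B]
    (hgrA : ∀ g h, ∀ a ∈ 𝒜 g, ∀ b ∈ 𝒜 h, a * b ∈ 𝒜 (g + h))
    (hgrB : ∀ g h, ∀ a ∈ ℬ g, ∀ b ∈ ℬ h, a * b ∈ ℬ (g + h))
    (hA1 : ∀ a, stA (stA a) = a) (hA2 : ∀ a b, stA (a * b) = stA b * stA a)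
    (hA3 : ∀ g, ∀ a ∈ 𝒜 g, stA a ∈ 𝒜 g)
    (hB1 : ∀ a, stB (stB a) = a) (hB2 : ∀ a b, stB (a * b) = stB b * stB a)
    (hB3 : ∀ g, ∀ a ∈ ℬ g, stB a ∈ ℬ g)
    (hA : IsSuperStarSimple 𝒜 stA)
    (hsame : ∀ f, IsSuperStarPI 𝒜 stA f ↔ IsSuperStarPI ℬ stB f)
    (hle : finrank K B ≤ finrank K A) :
    ∃ φ : A ≃ₗ[K] B, (∀ a b, φ (a * b) = φ a * φ b) ∧
      ∀ s a, φ (superStarOp 𝒜 stA s a) = superStarOp ℬ stB s (φ a) := by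
  have : Nontrivial A := by
    obtain ⟨a, b, hab⟩ := hA.1
    exact ⟨_, _, hab⟩
  exact exists_equiv_of_isPolynomialPairs
    (isPolynomialPairs_evaluationPairs _ hgrA hgrB hA1 hA2 hA3 hB1 hB2 hB3 hsame)
    (multiplicationAlgebra_eq_top _ hA.eq_bot_or_eq_top) hA.1 hle

end Evaluation

end SameIdentities

theorem superStarSimple_same_identities_isomorphic
    (K A B : Type*) [Field K] [IsAlgClosed K]
    [NonUnitalNonAssocRing A] [Module K A] [SMulCommClass K A A] [IsScalarTower K A A]
    [FiniteDimensional K A]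
    [NonUnitalNonAssocRing B] [Module K B] [SMulCommClass K B B] [IsScalarTower K B B]
    [FiniteDimensional K B]
    (𝒜 : ZMod 2 → Submodule K A) [DirectSum.Decomposition 𝒜]
    (hgrA : ∀ (g h : ZMod 2), ∀ a ∈ 𝒜 g, ∀ b ∈ 𝒜 h, a * b ∈ 𝒜 (g + h))
    (ℬ : ZMod 2 → Submodule K B) [DirectSum.Decomposition ℬ]
    (hgrB : ∀ (g h : ZMod 2), ∀ a ∈ ℬ g, ∀ b ∈ ℬ h, a * b ∈ ℬ (g + h))
    (stA : A →ₗ[K] A) (hA1 : ∀ a : A, stA (stA a) = a)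
    (hA2 : ∀ a b : A, stA (a * b) = stA b * stA a)
    (hA3 : ∀ (g : ZMod 2), ∀ a ∈ 𝒜 g, stA a ∈ 𝒜 g)
    (stB : B →ₗ[K] B) (hB1 : ∀ a : B, stB (stB a) = a)
    (hB2 : ∀ a b : B, stB (a * b) = stB b * stB a)
    (hB3 : ∀ (g : ZMod 2), ∀ a ∈ ℬ g, stB a ∈ ℬ g)
    (hAs : IsSuperStarSimple 𝒜 stA) (hBs : IsSuperStarSimple ℬ stB)
    (hsame : ∀ f : FreeNonUnitalNonAssocAlgebra K (ℕ × ZMod 2 × Bool),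
      IsSuperStarPI 𝒜 stA f ↔ IsSuperStarPI ℬ stB f) :
    ∃ φ : A ≃ₗ[K] B, (∀ a b : A, φ (a * b) = φ a * φ b) ∧
      (∀ g, Submodule.map (φ : A →ₗ[K] B) (𝒜 g) = ℬ g) ∧
      ∀ a : A, φ (stA a) = stB (φ a) := by
  rcases le_total (Module.finrank K B) (Module.finrank K A) with hle | hle
  · obtain ⟨φ, hmul, hop⟩ := exists_superStarEquiv_of_finrank_le hgrA hgrB hA1 hA2 hA3 hB1 hB2 hB3
      hAs hsame hle
    exact ⟨φ, hmul, map_eq_of_map_superStarOp φ hop, hop none⟩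
  · obtain ⟨φ, hmul, hop⟩ := exists_superStarEquiv_of_finrank_le hgrB hgrA hB1 hB2 hB3 hA1 hA2 hA3
      hBs (fun f ↦ (hsame f).symm) hle
    have hop' (s : Option (ZMod 2)) (a : A) :
        φ.symm (superStarOp 𝒜 stA s a) = superStarOp ℬ stB s (φ.symm a) :=
      φ.injective (by simp [hop])
    exact ⟨φ.symm, fun a b ↦ φ.injective (by simp [hmul]), map_eq_of_map_superStarOp φ.symm hop',
      hop' none⟩
end
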